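/- There exists an absolute constant M₀ > 0 such that for every lacunary sequence Λ = (λ_j)_{j∈ℕ₀} of positive integers with ratio ρ_Λ ∈ (1,2) and every g ∈ H¹_A(𝕋), one has ‖S^{(Λ)}(g)‖_{L^{1,∞}(𝕋)} ≤ M₀ (ρ_Λ − 1)^{-1/2} ‖g‖_{L¹(𝕋)}. -/

import Mathlib

open MeasureTheory Real Complex
open scoped ENNReal

noncomputable section

instance : Fact (0 < 2 * π) := ⟨by positivity⟩

/-- The torus `ℝ/(2πℤ)`. -/
abbrev Tor := AddCircle (2 * π)

/-- The normalized Haar measure `(2π)⁻¹ dx` on the torus. -/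
def haarT : Measure Tor := AddCircle.haarAddCircle

/-- The `j`-th Littlewood–Paley projection associated with the sequence `Λ`:
`Δ₀ f = Σ_{|n| < Λ 0} f̂(n) eⁿ` and, for `j ≥ 1`,
`Δ_j f = Σ_{Λ(j-1) ≤ |n| < Λ j} f̂(n) eⁿ`. -/
def LPproj (Λ : ℕ → ℕ) (j : ℕ) (f : Tor → ℂ) (x : Tor) : ℂ :=
  if j = 0 then
    ∑ n ∈ Finset.Ioo (-(Λ 0 : ℤ)) (Λ 0 : ℤ), fourierCoeff f n * fourier n x
  else
    ∑ n ∈ (Finset.Ico ((Λ (j-1) : ℤ)) ((Λ j : ℤ)) ∪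
        Finset.Ioc (-(Λ j : ℤ)) (-(Λ (j-1) : ℤ))),
      fourierCoeff f n * fourier n x

/-- The Littlewood–Paley square function `S^{(Λ)}(f) = (Σ_j |Δ_j f|²)^{1/2}`. -/
def LPsq (Λ : ℕ → ℕ) (f : Tor → ℂ) (x : Tor) : ℝ :=
  Real.sqrt (∑' j : ℕ, ‖LPproj Λ j f x‖ ^ 2)

/-- The ratio `ρ_Λ = inf_j Λ(j+1)/Λ(j)` of a sequence `Λ`. -/
def ratio (Λ : ℕ → ℕ) : ℝ := ⨅ j : ℕ, (Λ (j+1) : ℝ) / (Λ j : ℝ)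

/-- The weak-`L¹` quasinorm `sup_{α>0} α·|{|g| > α}|` with respect to the normalized
measure on the torus. -/
def wkNorm1 (g : Tor → ℝ) : ℝ≥0∞ :=
  ⨆ (α : ℝ) (_ : 0 < α), ENNReal.ofReal α * haarT {x | α < |g x|}

/-! ### Characters and integrals on the torus -/

instance : IsProbabilityMeasure haarT := by unfold haarT; infer_instance

instance : haarT.IsAddHaarMeasure := by unfold haarT; infer_instance

/-- The basic character `θ ↦ e^{iθ}` of the torus. -/
def uexp (θ : Tor) : ℂ := (AddCircle.toCircle θ : ℂ)

@[fun_prop]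
lemma continuous_uexp : Continuous uexp :=
  continuous_subtype_val.comp AddCircle.continuous_toCircle

@[simp]
lemma norm_uexp (θ : Tor) : ‖uexp θ‖ = 1 := Circle.norm_coe _

lemma uexp_ne_zero (θ : Tor) : uexp θ ≠ 0 := Circle.coe_ne_zero _

lemma uexp_add (a b : Tor) : uexp (a + b) = uexp a * uexp b := by
  simp [uexp, AddCircle.toCircle_add]

lemma uexp_neg (a : Tor) : uexp (-a) = (uexp a)⁻¹ := by
  simp [uexp, AddCircle.toCircle_neg]

lemma uexp_sub (a b : Tor) : uexp (a - b) = uexp a / uexp b := by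
  rw [sub_eq_add_neg, uexp_add, uexp_neg, div_eq_mul_inv]

lemma conj_uexp (a : Tor) : (starRingEnd ℂ) (uexp a) = (uexp a)⁻¹ :=
  (Complex.inv_eq_conj (norm_uexp a)).symm

lemma fourier_eq_uexp_zpow (n : ℤ) (θ : Tor) : fourier n θ = uexp θ ^ n := by
  simp [fourier_apply, uexp, AddCircle.toCircle_zsmul]

lemma uexp_coe (x : ℝ) : uexp (x : Tor) = circleMap 0 1 x := by
  simp [uexp, AddCircle.toCircle_apply_mk, circleMap, Circle.coe_exp]

lemma integrable_haarT {E : Type*} [NormedAddCommGroup E] {F : Tor → E} (hF : Continuous F) :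
    Integrable F haarT :=
  hF.integrable_of_hasCompactSupport (HasCompactSupport.of_compactSpace F)

lemma integral_haarT_uexp {E : Type*} [NormedAddCommGroup E] [NormedSpace ℝ E] (F : ℂ → E) :
    ∫ θ, F (uexp θ) ∂haarT = Real.circleAverage F 0 1 := by
  have h := AddCircle.integral_haarAddCircle (T := 2 * π) (f := fun θ => F (uexp θ))
  rw [haarT, h, Real.circleAverage_def, ← AddCircle.intervalIntegral_preimage (2 * π) 0]
  simp [uexp_coe]

lemma integral_uexp_zpow (n : ℤ) : ∫ θ, uexp θ ^ n ∂haarT = if n = 0 then 1 else 0 := by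
  split_ifs with h
  · simp [h]
  · have h2 := integral_eq_zero_of_add_right_eq_neg (μ := haarT)
      (f := fun θ : Tor => (fourier n θ : ℂ)) (fourier_add_half_inv_index h (by positivity))
    simpa only [fourier_eq_uexp_zpow] using h2

lemma integral_uexp_pow (n : ℕ) : ∫ θ, uexp θ ^ n ∂haarT = if n = 0 then 1 else 0 := by
  simpa using integral_uexp_zpow n

@[fun_prop]
lemma Polynomial.continuous_eval {X : Type*} [TopologicalSpace X] (Q : Polynomial ℂ) {f : X → ℂ}
    (hf : Continuous f) : Continuous fun x => Q.eval (f x) :=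
  Q.continuous.comp hf

lemma integral_eval_uexp (Q : Polynomial ℂ) : ∫ θ, Q.eval (uexp θ) ∂haarT = Q.coeff 0 := by
  simp_rw [Polynomial.eval_eq_sum_range]
  rw [integral_finsetSum _ fun i _ => integrable_haarT (by fun_prop)]
  simp_rw [integral_const_mul, integral_uexp_pow]
  simp

/-- Mean value property of polynomials. -/
lemma integral_eval_circle (Q : Polynomial ℂ) (z r : ℂ) :
    ∫ θ, Q.eval (z + r * uexp θ) ∂haarT = Q.eval z := by
  have := integral_eval_uexp (Q.comp (Polynomial.C z + Polynomial.C r * Polynomial.X))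
  simpa [Polynomial.eval_comp, Polynomial.coeff_zero_eq_eval_zero] using this

lemma integral_re' {F : Tor → ℂ} (hF : Integrable F haarT) :
    ∫ θ, (F θ).re ∂haarT = (∫ θ, F θ ∂haarT).re := integral_re hF

lemma integral_conj' {F : Tor → ℂ} :
    ∫ θ, (starRingEnd ℂ) (F θ) ∂haarT = (starRingEnd ℂ) (∫ θ, F θ ∂haarT) := integral_conj

/-! ### The Poisson kernel -/

/-- The Poisson kernel of the disc. -/
def pker (ρ : ℝ) (s : Tor) : ℝ := (1 - ρ ^ 2) / ‖1 - ρ * uexp s‖ ^ 2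

lemma norm_mul_uexp {ρ : ℝ} (h0 : 0 ≤ ρ) (s : Tor) : ‖(ρ : ℂ) * uexp s‖ = ρ := by
  simp [abs_of_nonneg h0]

lemma one_sub_mul_uexp_ne_zero {ρ : ℝ} (h0 : 0 ≤ ρ) (h1 : ρ < 1) (s : Tor) :
    1 - (ρ : ℂ) * uexp s ≠ 0 := by
  intro h
  have := norm_mul_uexp h0 s
  rw [← sub_eq_zero.1 h] at this
  simp at this
  linarith

lemma continuous_pker {ρ : ℝ} (h0 : 0 ≤ ρ) (h1 : ρ < 1) : Continuous (pker ρ) := by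
  unfold pker
  refine continuous_const.div (by fun_prop) fun s => ?_
  have := one_sub_mul_uexp_ne_zero h0 h1 s
  positivity

lemma pker_nonneg {ρ : ℝ} (h0 : 0 ≤ ρ) (h1 : ρ < 1) (s : Tor) : 0 ≤ pker ρ s := by
  unfold pker
  have : 0 ≤ 1 - ρ ^ 2 := by nlinarith
  positivity

lemma pker_neg (ρ : ℝ) (s : Tor) : pker ρ (-s) = pker ρ s := by
  unfold pker
  have : 1 - (ρ : ℂ) * uexp (-s) = (starRingEnd ℂ) (1 - ρ * uexp s) := by
    simp [uexp_neg, conj_uexp]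
  rw [this, RCLike.norm_conj]

lemma pker_comm (ρ : ℝ) (θ φ : Tor) : pker ρ (θ - φ) = pker ρ (φ - θ) := by
  rw [← pker_neg, neg_sub]

lemma pker_eq_poissonKernel {ρ : ℝ} (h0 : 0 ≤ ρ) (θ φ : Tor) :
    pker ρ (θ - φ) = poissonKernel 0 (ρ * uexp φ) (uexp θ) := by
  rw [pker_comm, pker, poissonKernel]
  have : (1 : ℂ) - ρ * uexp (φ - θ) = (uexp θ - ρ * uexp φ) / uexp θ := by
    rw [uexp_sub, sub_div, div_self (uexp_ne_zero θ)]; ring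
  simp [this, abs_of_nonneg h0]

lemma integral_pker_eval {ρ : ℝ} (h0 : 0 ≤ ρ) (h1 : ρ < 1) (φ : Tor) (Q : Polynomial ℂ) :
    ∫ θ, (pker ρ (θ - φ) : ℂ) * Q.eval (uexp θ) ∂haarT = Q.eval (ρ * uexp φ) := by
  have hw : (ρ : ℂ) * uexp φ ∈ Metric.ball (0 : ℂ) 1 := by
    simpa [abs_of_nonneg h0] using h1
  have h := DiffContOnCl.circleAverage_poissonKernel_smul (R := 1) (c := 0)
    (f := fun z => Q.eval z) (w := ρ * uexp φ) Q.differentiable.diffContOnCl hw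
  rw [← h, ← integral_haarT_uexp]
  refine integral_congr_ae (.of_forall fun θ => ?_)
  simp [pker_eq_poissonKernel h0]

lemma integral_pker {ρ : ℝ} (h0 : 0 ≤ ρ) (h1 : ρ < 1) (φ : Tor) :
    ∫ θ, pker ρ (θ - φ) ∂haarT = 1 := by
  have := integral_pker_eval h0 h1 φ 1
  simp only [Polynomial.eval_one, mul_one] at this
  rw [integral_complex_ofReal] at this
  exact_mod_cast this

lemma pker_zero (s : Tor) : pker 0 s = 1 := by simp [pker]

/-! ### Maximum principle for continuous subharmonic functions -/

/-- The local sub-mean value property on the open unit disc. -/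
def LocSubMean (ψ : ℂ → ℝ) : Prop :=
  ∀ z : ℂ, ‖z‖ < 1 → ∃ ε > 0, ∀ r : ℝ, 0 < r → r < ε →
    ψ z ≤ ∫ θ, ψ (z + r * uexp θ) ∂haarT

lemma integral_norm_sq_circle (z : ℂ) (r : ℝ) :
    ∫ θ, ‖z + r * uexp θ‖ ^ 2 ∂haarT = ‖z‖ ^ 2 + r ^ 2 := by
  have h : ∀ θ, ‖z + r * uexp θ‖ ^ 2 = ‖z‖ ^ 2 + r ^ 2 +
      (2 * ((starRingEnd ℂ z * r) * uexp θ)).re := by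
    intro θ
    have h1 : ‖uexp θ‖ ^ 2 = 1 := by simp
    rw [Complex.sq_norm, Complex.normSq_apply] at h1
    simp only [Complex.sq_norm, Complex.normSq_apply, Complex.add_re, Complex.mul_re,
      Complex.ofReal_re, Complex.ofReal_im, Complex.add_im, Complex.mul_im, Complex.conj_re,
      Complex.conj_im, Complex.re_ofNat, Complex.im_ofNat]
    linear_combination r ^ 2 * h1
  simp_rw [h]
  rw [integral_add (integrable_haarT (by fun_prop)) (integrable_haarT (by fun_prop)),
    integral_re' (integrable_haarT (by fun_prop)), integral_const_mul, integral_const_mul]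
  have := integral_uexp_pow 1
  simp only [pow_one, one_ne_zero, if_false] at this
  simp [this]

lemma exists_uexp_eq {z : ℂ} (hz : ‖z‖ = 1) : ∃ θ, uexp θ = z := by
  refine ⟨(Complex.arg z : ℝ), ?_⟩
  rw [uexp_coe]
  have := Complex.norm_mul_exp_arg_mul_I z
  simpa [circleMap, hz] using this

lemma LocSubMean.le_zero {u : ℂ → ℝ} (hu : LocSubMean u) (hc : Continuous u)
    (hb : ∀ θ, u (uexp θ) ≤ 0) {z : ℂ} (hz : ‖z‖ ≤ 1) : u z ≤ 0 := by
  refine le_of_forall_pos_le_add fun δ hδ => ?_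
  rw [zero_add]
  have hvc : Continuous fun w : ℂ => u w + δ * ‖w‖ ^ 2 := by fun_prop
  obtain ⟨w, hw, hmax⟩ := (isCompact_closedBall (0 : ℂ) 1).exists_isMaxOn
    ⟨z, by simpa using hz⟩ hvc.continuousOn
  have hw' : ‖w‖ ≤ 1 := by simpa using hw
  have hmax' : ∀ y : ℂ, ‖y‖ ≤ 1 → u y + δ * ‖y‖ ^ 2 ≤ u w + δ * ‖w‖ ^ 2 := fun y hy =>
    hmax (by simpa using hy)
  rcases hw'.lt_or_eq with hlt | heq
  · exfalso
    obtain ⟨ε, hε, h⟩ := hu w hlt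
    obtain ⟨r, hr0, hr⟩ := exists_between (lt_min hε (sub_pos.2 hlt))
    have hr1 := lt_of_lt_of_le hr (min_le_left _ _)
    have hr2 := lt_of_lt_of_le hr (min_le_right _ _)
    have h1 := h r hr0 hr1
    have h2 : ∫ θ, (u (w + r * uexp θ) + δ * ‖w + r * uexp θ‖ ^ 2) ∂haarT ≤
        ∫ _θ : Tor, (u w + δ * ‖w‖ ^ 2) ∂haarT := by
      refine integral_mono (integrable_haarT (by fun_prop)) (integrable_haarT (by fun_prop))
        fun θ => hmax' _ ?_
      calc ‖w + r * uexp θ‖ ≤ ‖w‖ + ‖(r : ℂ) * uexp θ‖ := norm_add_le _ _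
        _ ≤ 1 := by rw [norm_mul_uexp hr0.le]; linarith
    rw [integral_add (integrable_haarT (by fun_prop)) (integrable_haarT (by fun_prop)),
      integral_const_mul, integral_norm_sq_circle] at h2
    simp at h2
    nlinarith [mul_pos hδ (pow_pos hr0 2)]
  · obtain ⟨θ, rfl⟩ := exists_uexp_eq heq
    have h1 := hmax' z hz
    have h2 := hb θ
    simp only [norm_uexp] at h1
    nlinarith [mul_nonneg hδ.le (sq_nonneg ‖z‖)]

lemma exists_polynomial_of_mem_span {p : C(Tor, ℂ)}
    (hp : p ∈ Submodule.span ℂ (Set.range (fourier (T := 2 * π)))) :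
    ∃ Q R : Polynomial ℂ, ∀ θ, p θ = Q.eval (uexp θ) + (starRingEnd ℂ) (R.eval (uexp θ)) := by
  induction hp using Submodule.span_induction with
  | mem x hx =>
    obtain ⟨n, rfl⟩ := hx
    obtain ⟨m, rfl | rfl⟩ := n.eq_nat_or_neg
    · exact ⟨Polynomial.X ^ m, 0, fun θ => by rw [fourier_eq_uexp_zpow]; simp⟩
    · exact ⟨0, Polynomial.X ^ m, fun θ => by rw [fourier_eq_uexp_zpow]; simp [conj_uexp]⟩
  | zero => exact ⟨0, 0, by simp⟩
  | add x y _ _ hx hy =>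
    obtain ⟨Q, R, h⟩ := hx
    obtain ⟨Q', R', h'⟩ := hy
    exact ⟨Q + Q', R + R', fun θ => by simp [h, h']; ring⟩
  | smul a x _ hx =>
    obtain ⟨Q, R, h⟩ := hx
    exact ⟨Polynomial.C a * Q, Polynomial.C (starRingEnd ℂ a) * R, fun θ => by simp [h]; ring⟩

lemma exists_polynomial_re_near {f : Tor → ℝ} (hf : Continuous f) {ε : ℝ} (hε : 0 < ε) :
    ∃ Q : Polynomial ℂ, ∀ θ, |f θ - (Q.eval (uexp θ)).re| ≤ ε := by
  let F : C(Tor, ℂ) := ⟨fun θ => (f θ : ℂ), by fun_prop⟩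
  have hF : F ∈ (Submodule.span ℂ (Set.range (fourier (T := 2 * π)))).topologicalClosure := by
    rw [span_fourier_closure_eq_top]; trivial
  obtain ⟨p, hp, hd⟩ := Metric.mem_closure_iff.1 hF ε hε
  obtain ⟨Q, R, h⟩ := exists_polynomial_of_mem_span hp
  refine ⟨Q + R, fun θ => ?_⟩
  have h1 : ‖F θ - p θ‖ ≤ ε := by
    rw [← dist_eq_norm]; exact (ContinuousMap.dist_apply_le_dist θ).trans hd.le
  refine le_trans ?_ h1
  have h2 := Complex.abs_re_le_norm (F θ - p θ)
  rw [h] at h2 ⊢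
  simpa [F] using h2

/-- A continuous function on the closed disc with the local sub-mean value property is dominated
by the Poisson integral of its boundary values. -/
lemma LocSubMean.le_poisson {ψ : ℂ → ℝ} (hψ : LocSubMean ψ) (hc : Continuous ψ) {ρ : ℝ}
    (h0 : 0 ≤ ρ) (h1 : ρ < 1) (φ : Tor) :
    ψ (ρ * uexp φ) ≤ ∫ θ, pker ρ (θ - φ) * ψ (uexp θ) ∂haarT := by
  have hP : Continuous fun θ => pker ρ (θ - φ) :=
    (continuous_pker h0 h1).comp (continuous_id.sub continuous_const)
  refine le_of_forall_pos_le_add fun δ hδ => ?_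
  obtain ⟨Q, hQ⟩ := exists_polynomial_re_near (f := fun θ => ψ (uexp θ)) (by fun_prop)
    (half_pos hδ)
  have hsub : LocSubMean fun z => ψ z - (Q.eval z).re - δ / 2 := by
    intro z hz
    obtain ⟨ε, hε, h⟩ := hψ z hz
    refine ⟨ε, hε, fun r hr hr' => ?_⟩
    rw [integral_sub (integrable_haarT (by fun_prop)) (integrable_haarT (by fun_prop)),
      integral_sub (integrable_haarT (by fun_prop)) (integrable_haarT (by fun_prop)),
      integral_re' (integrable_haarT (by fun_prop)), integral_eval_circle]
    simpa using h r hr hr'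
  have h2 := hsub.le_zero (by fun_prop) (fun θ => by
    have := (abs_le.1 (hQ θ)).2
    simpa using this) (z := ρ * uexp φ) (by rw [norm_mul_uexp h0]; exact h1.le)
  have h3 : (Q.eval (ρ * uexp φ)).re = ∫ θ, pker ρ (θ - φ) * (Q.eval (uexp θ)).re ∂haarT := by
    rw [← integral_pker_eval h0 h1, ← integral_re' (integrable_haarT (by fun_prop))]
    simp
  have h4 : ∫ θ, pker ρ (θ - φ) * (Q.eval (uexp θ)).re ∂haarT ≤
      ∫ θ, (pker ρ (θ - φ) * ψ (uexp θ) + pker ρ (θ - φ) * (δ / 2)) ∂haarT := by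
    refine integral_mono (integrable_haarT (by fun_prop)) (integrable_haarT (by fun_prop))
      fun θ => ?_
    have := (abs_le.1 (hQ θ)).1
    have hp := pker_nonneg h0 h1 (θ - φ)
    simp only []
    rw [← mul_add]
    gcongr
    linarith
  rw [integral_add (integrable_haarT (by fun_prop)) (integrable_haarT (by fun_prop)),
    integral_mul_const, integral_pker h0 h1] at h4
  linarith

/-! ### The `ℓ²` norm of a finite family -/

/-- The `ℓ²` norm of a finite family of complex numbers. -/
def l2 {ι : Type*} [Fintype ι] (f : ι → ℂ) : ℝ := Real.sqrt (∑ i, ‖f i‖ ^ 2)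

section l2

variable {ι : Type*} [Fintype ι]

lemma l2_eq_norm (f : ι → ℂ) : l2 f = ‖WithLp.toLp 2 f‖ := by
  rw [l2, EuclideanSpace.norm_eq]

lemma l2_nonneg (f : ι → ℂ) : 0 ≤ l2 f := Real.sqrt_nonneg _

lemma l2_sq (f : ι → ℂ) : l2 f ^ 2 = ∑ i, ‖f i‖ ^ 2 :=
  Real.sq_sqrt (Finset.sum_nonneg fun _ _ => by positivity)

lemma l2_add_le (f g : ι → ℂ) : l2 (fun i => f i + g i) ≤ l2 f + l2 g := by
  simp only [l2_eq_norm]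
  exact norm_add_le (WithLp.toLp 2 f) (WithLp.toLp 2 g)

lemma l2_sub_le (f g : ι → ℂ) : l2 (fun i => f i - g i) ≤ l2 f + l2 g := by
  simp only [l2_eq_norm]
  exact norm_sub_le (WithLp.toLp 2 f) (WithLp.toLp 2 g)

lemma l2_mul (a : ℂ) (f : ι → ℂ) : l2 (fun i => a * f i) = ‖a‖ * l2 f := by
  simp only [l2_eq_norm]
  exact norm_smul a (WithLp.toLp 2 f)

lemma l2_mono {κ : Type*} [Fintype κ] {f : ι → ℂ} {g : κ → ℂ}
    (h : ∑ i, ‖f i‖ ^ 2 ≤ ∑ i, ‖g i‖ ^ 2) : l2 f ≤ l2 g := Real.sqrt_le_sqrt h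

@[fun_prop]
lemma continuous_l2 {X : Type*} [TopologicalSpace X] {f : X → ι → ℂ}
    (hf : ∀ i, Continuous fun x => f x i) : Continuous fun x => l2 (f x) := by
  unfold l2
  fun_prop

/-- Minkowski's integral inequality for `ℓ²`-valued functions. -/
lemma l2_integral_le {X : Type*} [MeasurableSpace X] {μ : Measure X} {F : X → ι → ℂ}
    (hF : ∀ i, Integrable (fun x => F x i) μ) :
    l2 (fun i => ∫ x, F x i ∂μ) ≤ ∫ x, l2 (F x) ∂μ := by
  have h : WithLp.toLp 2 (fun i => ∫ x, F x i ∂μ) =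
      ∫ x, (WithLp.toLp 2 (F x) : EuclideanSpace ℂ ι) ∂μ := by
    ext i
    rw [eval_integral_piLp (f := fun x => (WithLp.toLp 2 (F x) : EuclideanSpace ℂ ι)) hF]
  simp only [l2_eq_norm, h]
  exact norm_integral_le_integral_norm _

end l2

/-! ### A weak-type inequality for conjugate functions -/

section weak

variable {ι : Type*} [Fintype ι] (a b : ι → Polynomial ℂ)

/-- The `ℓ²` norm of `a + conj b`. -/
def sumNorm (z : ℂ) : ℝ := l2 fun i => (a i).eval z + (starRingEnd ℂ) ((b i).eval z)

/-- The `ℓ²` norm of `a - conj b`. -/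
def diffNorm (z : ℂ) : ℝ := l2 fun i => (a i).eval z - (starRingEnd ℂ) ((b i).eval z)

@[fun_prop]
lemma continuous_sumNorm {X : Type*} [TopologicalSpace X] {f : X → ℂ} (hf : Continuous f) :
    Continuous fun x => sumNorm a b (f x) := by
  unfold sumNorm; fun_prop

@[fun_prop]
lemma continuous_diffNorm {X : Type*} [TopologicalSpace X] {f : X → ℂ} (hf : Continuous f) :
    Continuous fun x => diffNorm a b (f x) := by
  unfold diffNorm; fun_prop

/-- Burkholder's function for the weak-type inequality at level `t`. -/
def burk (t : ℝ) (z : ℂ) : ℝ :=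
  if t ≤ sumNorm a b z + diffNorm a b z then t ^ 2 - 2 * t * sumNorm a b z
  else diffNorm a b z ^ 2 - sumNorm a b z ^ 2

@[fun_prop]
lemma continuous_burk (t : ℝ) {X : Type*} [TopologicalSpace X] {f : X → ℂ} (hf : Continuous f) :
    Continuous fun x => burk a b t (f x) := by
  unfold burk
  refine Continuous.if_le (by fun_prop) (by fun_prop) continuous_const (by fun_prop) fun x hx => ?_
  rw [hx]; ring

lemma sumNorm_nonneg (z : ℂ) : 0 ≤ sumNorm a b z := l2_nonneg _

lemma diffNorm_nonneg (z : ℂ) : 0 ≤ diffNorm a b z := l2_nonneg _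

lemma burk_le (t : ℝ) (z : ℂ) : burk a b t z ≤ t ^ 2 - 2 * t * sumNorm a b z := by
  unfold burk
  split_ifs with h
  · exact le_rfl
  · have := diffNorm_nonneg a b z
    nlinarith

lemma sumNorm_le_integral (z : ℂ) (r : ℝ) :
    sumNorm a b z ≤ ∫ θ, sumNorm a b (z + r * uexp θ) ∂haarT := by
  have h : ∀ i, (a i).eval z + (starRingEnd ℂ) ((b i).eval z) =
      ∫ θ, ((a i).eval (z + r * uexp θ) + (starRingEnd ℂ) ((b i).eval (z + r * uexp θ))) ∂haarT := by
    intro i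
    rw [integral_add (integrable_haarT (by fun_prop)) (integrable_haarT (by fun_prop)),
      integral_conj', integral_eval_circle, integral_eval_circle]
  unfold sumNorm
  simp_rw [h]
  exact l2_integral_le fun i => integrable_haarT (by fun_prop)

lemma diffNorm_sq_sub (z : ℂ) : diffNorm a b z ^ 2 - sumNorm a b z ^ 2 =
    ((Polynomial.C (-4) * ∑ i, a i * b i).eval z).re := by
  simp only [diffNorm, sumNorm, l2_sq, ← Finset.sum_sub_distrib, Polynomial.eval_mul,
    Polynomial.eval_finsetSum, Polynomial.eval_C, Finset.mul_sum, Complex.re_sum]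
  refine Finset.sum_congr rfl fun i _ => ?_
  simp only [Complex.sq_norm, Complex.normSq_apply, Complex.add_re, Complex.mul_re,
    Complex.add_im, Complex.mul_im, Complex.conj_re, Complex.sub_re, Complex.sub_im,
    Complex.conj_im, Complex.re_ofNat, Complex.im_ofNat, Complex.neg_re, Complex.neg_im]
  ring

lemma locSubMean_neg_burk {t : ℝ} (ht : 0 < t) : LocSubMean fun z => -burk a b t z := by
  intro z _
  by_cases h : t ≤ sumNorm a b z + diffNorm a b z
  · refine ⟨1, one_pos, fun r _ _ => ?_⟩
    have h1 : ∫ θ, -(t ^ 2 - 2 * t * sumNorm a b (z + r * uexp θ)) ∂haarT ≤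
        ∫ θ, -burk a b t (z + r * uexp θ) ∂haarT :=
      integral_mono (integrable_haarT (by fun_prop)) (integrable_haarT (by fun_prop))
        fun θ => neg_le_neg (burk_le a b t _)
    refine le_trans ?_ h1
    rw [integral_neg, integral_sub (integrable_haarT (by fun_prop))
      (integrable_haarT (by fun_prop)), integral_const_mul]
    have := sumNorm_le_integral a b z r
    simp only [burk, if_pos h, integral_const, probReal_univ, one_smul, neg_sub]
    nlinarith
  · have ho : IsOpen {w : ℂ | sumNorm a b w + diffNorm a b w < t} :=
      isOpen_lt (by fun_prop) continuous_const
    obtain ⟨ε, hε, hb⟩ := Metric.isOpen_iff.1 ho z (not_le.1 h)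
    refine ⟨ε, hε, fun r hr hr' => le_of_eq ?_⟩
    have h2 : ∀ θ, burk a b t (z + r * uexp θ) =
        ((Polynomial.C (-4) * ∑ i, a i * b i).eval (z + r * uexp θ)).re := by
      intro θ
      have : z + r * uexp θ ∈ Metric.ball z ε := by
        rw [mem_ball_iff_norm, add_sub_cancel_left, norm_mul_uexp hr.le]; exact hr'
      rw [burk, if_neg (not_le.2 (hb this)), diffNorm_sq_sub]
    simp only [h2]
    rw [integral_neg, integral_re' (integrable_haarT (by fun_prop)), integral_eval_circle,
      burk, if_neg h, diffNorm_sq_sub]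

lemma integral_burk_nonpos {t : ℝ} (ht : 0 < t) (hb : ∀ i, (b i).eval 0 = 0) :
    ∫ θ, burk a b t (uexp θ) ∂haarT ≤ 0 := by
  have h := (locSubMean_neg_burk a b ht).le_poisson (by fun_prop) le_rfl one_pos 0
  simp only [pker_zero, ofReal_zero, zero_mul, one_mul] at h
  rw [integral_neg] at h
  have h0 : diffNorm a b 0 = sumNorm a b 0 := by simp [diffNorm, sumNorm, hb]
  have : burk a b t 0 ≤ 0 := by
    unfold burk
    rw [h0]
    split_ifs with h1
    · nlinarith
    · simp
  linarith

/-- Weak-type inequality for the (vector valued) antianalytic projection. -/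
lemma weak_conj (hb : ∀ i, (b i).eval 0 = 0) {α : ℝ} (hα : 0 < α) :
    α * haarT.real {θ | α < l2 fun i => (b i).eval (uexp θ)} ≤
      ∫ θ, sumNorm a b (uexp θ) ∂haarT := by
  set E := {θ | α < l2 fun i => (b i).eval (uexp θ)} with hE
  have hEm : MeasurableSet E := (isOpen_lt continuous_const (by fun_prop)).measurableSet
  have hpt : ∀ θ, E.indicator (fun _ => (2 * α) ^ 2) θ ≤
      burk a b (2 * α) (uexp θ) + 2 * (2 * α) * sumNorm a b (uexp θ) := by
    intro θ
    have hs := sumNorm_nonneg a b (uexp θ)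
    have hd := diffNorm_nonneg a b (uexp θ)
    have h2b : 2 * l2 (fun i => (b i).eval (uexp θ)) ≤
        sumNorm a b (uexp θ) + diffNorm a b (uexp θ) := by
      have h1 : 2 * l2 (fun i => (b i).eval (uexp θ)) = l2 (fun i =>
          ((a i).eval (uexp θ) + (starRingEnd ℂ) ((b i).eval (uexp θ))) -
          ((a i).eval (uexp θ) - (starRingEnd ℂ) ((b i).eval (uexp θ)))) := by
        have : ∀ i, ((a i).eval (uexp θ) + (starRingEnd ℂ) ((b i).eval (uexp θ))) -
          ((a i).eval (uexp θ) - (starRingEnd ℂ) ((b i).eval (uexp θ))) =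
          2 * (starRingEnd ℂ) ((b i).eval (uexp θ)) := fun i => by ring
        simp only [this, l2_mul]
        simp [l2]
      rw [h1]
      exact l2_sub_le _ _
    by_cases hθ : θ ∈ E
    · rw [Set.indicator_of_mem hθ]
      have h3 : 2 * α ≤ sumNorm a b (uexp θ) + diffNorm a b (uexp θ) := by
        have : α < l2 fun i => (b i).eval (uexp θ) := hθ
        linarith
      rw [burk, if_pos h3]
      linarith
    · rw [Set.indicator_of_notMem hθ, burk]
      split_ifs with h3
      · nlinarith
      · nlinarith
  have h := integral_mono ((integrable_const _).indicator hEm) (integrable_haarT (by fun_prop)) hpt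
  rw [integral_indicator_const _ hEm, integral_add (integrable_haarT (by fun_prop))
    (integrable_haarT (by fun_prop)), integral_const_mul, smul_eq_mul] at h
  have h0 := integral_burk_nonpos a b (t := 2 * α) (by positivity) hb
  have h4 : (4 * α) * (α * haarT.real E) ≤ (4 * α) * ∫ θ, sumNorm a b (uexp θ) ∂haarT := by
    nlinarith
  exact le_of_mul_le_mul_left h4 (by positivity)

end weak

/-! ### A one-step square function estimate -/

lemma one_add_re_add_le_norm {w : ℂ} (hw : ‖w‖ ≤ 1 / 2) :
    1 + w.re + (1 / 8) * (‖w‖ ^ 2 - (w ^ 2).re) ≤ ‖1 + w‖ := by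
  have hx := (Complex.abs_re_le_norm w).trans hw
  have hy := (Complex.abs_im_le_norm w).trans hw
  rw [abs_le] at hx hy
  have h1 : ‖w‖ ^ 2 - (w ^ 2).re = 2 * w.im ^ 2 := by
    rw [Complex.sq_norm, Complex.normSq_apply, pow_two w, Complex.mul_re]; ring
  rw [h1]
  refine le_of_sq_le_sq (b := ‖1 + w‖) ?_ (norm_nonneg _)
  rw [Complex.sq_norm, Complex.normSq_apply]
  simp only [Complex.add_re, Complex.one_re, Complex.add_im, Complex.one_im, zero_add]
  have h2 : w.im ^ 2 ≤ 1 / 4 := by nlinarith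
  nlinarith [mul_nonneg (sq_nonneg w.im) (by linarith : (0:ℝ) ≤ 1 / 2 - w.re),
    mul_nonneg (sq_nonneg w.im) (by linarith : (0:ℝ) ≤ 1 / 4 - w.im ^ 2), sq_nonneg w.im]

/-- The function `w ↦ 8|w| - (s² + |w - c|² + |w|²)^{1/2}`. -/
def davis (s : ℝ) (c w : ℂ) : ℝ := 8 * ‖w‖ - Real.sqrt (s ^ 2 + ‖w - c‖ ^ 2 + ‖w‖ ^ 2)

lemma sqrt_le_tangent {q q₀ : ℝ} (hq : 0 ≤ q) (h0 : 0 < q₀) :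
    Real.sqrt q ≤ Real.sqrt q₀ + (q - q₀) / (2 * Real.sqrt q₀) := by
  have hs := Real.sqrt_pos.2 h0
  have h1 := Real.sq_sqrt h0.le
  have h2 := Real.sq_sqrt hq
  have : Real.sqrt q₀ + (q - q₀) / (2 * Real.sqrt q₀) - Real.sqrt q =
      (Real.sqrt q - Real.sqrt q₀) ^ 2 / (2 * Real.sqrt q₀) := by
    field_simp
    nlinarith
  have h3 : 0 ≤ (Real.sqrt q - Real.sqrt q₀) ^ 2 / (2 * Real.sqrt q₀) := by positivity
  linarith

lemma davis_quad (s : ℝ) (c w e : ℂ) :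
    s ^ 2 + ‖w + e - c‖ ^ 2 + ‖w + e‖ ^ 2 - (s ^ 2 + ‖w - c‖ ^ 2 + ‖w‖ ^ 2) =
      2 * ((starRingEnd ℂ) (2 * w - c) * e).re + 2 * ‖e‖ ^ 2 := by
  simp only [Complex.sq_norm, Complex.normSq_apply, Complex.add_re, Complex.mul_re, map_sub,
    map_mul, Complex.conj_ofNat,
    Complex.add_im, Complex.mul_im, Complex.conj_re, Complex.sub_re, Complex.sub_im,
    Complex.conj_im, Complex.re_ofNat, Complex.im_ofNat]
  ring

lemma davis_lower (s : ℝ) (c w : ℂ) : ∃ δ > 0, ∃ A B : ℂ, ∀ e : ℂ, ‖e‖ < δ →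
    davis s c w + (A * e + B * e ^ 2).re ≤ davis s c (w + e) := by
  set q₀ := s ^ 2 + ‖w - c‖ ^ 2 + ‖w‖ ^ 2 with hq₀
  have hq0 : 0 ≤ q₀ := by positivity
  rcases hq0.eq_or_lt with hz | hpos
  · have hw : w = 0 := by
      have : ‖w‖ ^ 2 = 0 := by nlinarith [sq_nonneg s, sq_nonneg ‖w - c‖, sq_nonneg ‖w‖]
      simpa using this
    have hs : s = 0 := by
      have : s ^ 2 = 0 := by nlinarith [sq_nonneg s, sq_nonneg ‖w - c‖, sq_nonneg ‖w‖]
      simpa using this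
    have hc : c = 0 := by
      have : ‖w - c‖ ^ 2 = 0 := by nlinarith [sq_nonneg s, sq_nonneg ‖w - c‖, sq_nonneg ‖w‖]
      simpa [hw] using this
    refine ⟨1, one_pos, 0, 0, fun e _ => ?_⟩
    subst hw hs hc
    have : Real.sqrt (‖e‖ ^ 2 + ‖e‖ ^ 2) ≤ 8 * ‖e‖ :=
      Real.sqrt_le_iff.2 ⟨by positivity, by nlinarith [sq_nonneg ‖e‖]⟩
    simpa [davis] using this
  · have hsq := Real.sqrt_pos.2 hpos
    have htan : ∀ e : ℂ, Real.sqrt (s ^ 2 + ‖w + e - c‖ ^ 2 + ‖w + e‖ ^ 2) ≤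
        Real.sqrt q₀ + (((starRingEnd ℂ) (2 * w - c) / (Real.sqrt q₀ : ℂ)) * e).re +
          ‖e‖ ^ 2 / Real.sqrt q₀ := by
      intro e
      have h := sqrt_le_tangent (q := s ^ 2 + ‖w + e - c‖ ^ 2 + ‖w + e‖ ^ 2) (by positivity) hpos
      rw [davis_quad] at h
      refine h.trans (le_of_eq ?_)
      rw [div_mul_eq_mul_div, Complex.div_ofReal_re]
      field_simp
      ring
    by_cases hw : w = 0
    · refine ⟨Real.sqrt q₀, hsq, -((starRingEnd ℂ) (2 * w - c) / (Real.sqrt q₀ : ℂ)), 0,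
        fun e he => ?_⟩
      have h := htan e
      have h2 : ‖e‖ ^ 2 / Real.sqrt q₀ ≤ ‖e‖ := by
        rw [div_le_iff₀ hsq]; nlinarith [norm_nonneg e]
      simp only [davis, ← hq₀]
      have h3 := norm_nonneg e
      rw [neg_mul, zero_mul, add_zero, Complex.neg_re]
      have h4 : ‖w + e‖ = ‖e‖ := by simp [hw]
      have h5 : ‖w‖ = 0 := by simp [hw]
      rw [h4] at h ⊢
      rw [h5]
      linarith
    · have hwn : 0 < ‖w‖ := norm_pos_iff.2 hw
      refine ⟨‖w‖ / 2, by positivity,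
        8 * ‖w‖ / w - ((starRingEnd ℂ) (2 * w - c) / (Real.sqrt q₀ : ℂ)),
        - ‖w‖ / w ^ 2, fun e he => ?_⟩
      have h := htan e
      have hle : ‖w‖ ≤ Real.sqrt q₀ := Real.le_sqrt_of_sq_le (by nlinarith [sq_nonneg s, sq_nonneg ‖w - c‖])
      have h2 : ‖e‖ ^ 2 / Real.sqrt q₀ ≤ ‖e‖ ^ 2 / ‖w‖ := by gcongr
      have h3 : ‖e / w‖ ≤ 1 / 2 := by
        rw [norm_div, div_le_iff₀ hwn]; linarith
      have h4 := one_add_re_add_le_norm h3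
      have h5 : ‖w + e‖ = ‖w‖ * ‖1 + e / w‖ := by
        rw [← norm_mul]; congr 1; field_simp
      have h6 : ‖w‖ * ‖e / w‖ ^ 2 = ‖e‖ ^ 2 / ‖w‖ := by
        rw [norm_div]; field_simp
      have h7 : ((8 * ‖w‖ / w - ((starRingEnd ℂ) (2 * w - c) / (Real.sqrt q₀ : ℂ))) * e +
          (- ‖w‖ / w ^ 2) * e ^ 2).re = 8 * ‖w‖ * (e / w).re - ‖w‖ * ((e / w) ^ 2).re -
          (((starRingEnd ℂ) (2 * w - c) / (Real.sqrt q₀ : ℂ)) * e).re := by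
        rw [show (8 * ‖w‖ / w - ((starRingEnd ℂ) (2 * w - c) / (Real.sqrt q₀ : ℂ))) * e +
          (- ‖w‖ / w ^ 2) * e ^ 2 = ((8 * ‖w‖ : ℝ) : ℂ) * (e / w) - (‖w‖ : ℂ) * (e / w) ^ 2 -
          ((starRingEnd ℂ) (2 * w - c) / (Real.sqrt q₀ : ℂ)) * e by push_cast; field_simp; ring]
        rw [Complex.sub_re, Complex.sub_re, Complex.re_ofReal_mul, Complex.re_ofReal_mul]
      rw [h7]
      simp only [davis, ← hq₀]
      rw [h5] at h ⊢
      nlinarith [mul_le_mul_of_nonneg_left h4 hwn.le]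

lemma locSubMean_davis (s : ℝ) (c : ℂ) (h : Polynomial ℂ) :
    LocSubMean fun z => davis s c (h.eval z) := by
  intro z _
  obtain ⟨δ, hδ, A, B, hAB⟩ := davis_lower s c (h.eval z)
  obtain ⟨ε, hε, hcont⟩ := Metric.continuous_iff.1 h.continuous z δ hδ
  refine ⟨ε, hε, fun r hr hr' => ?_⟩
  let Q : Polynomial ℂ := Polynomial.C A * (h - Polynomial.C (h.eval z)) +
    Polynomial.C B * (h - Polynomial.C (h.eval z)) ^ 2
  have h1 : ∫ θ, (davis s c (h.eval z) + (Q.eval (z + r * uexp θ)).re) ∂haarT ≤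
      ∫ θ, davis s c (h.eval (z + r * uexp θ)) ∂haarT := by
    refine integral_mono (integrable_haarT (by fun_prop))
      (integrable_haarT (by unfold davis; fun_prop)) fun θ => ?_
    have h2 := hAB (h.eval (z + r * uexp θ) - h.eval z) (by
      rw [← dist_eq_norm]
      refine hcont _ ?_
      rw [dist_eq_norm, add_sub_cancel_left, norm_mul_uexp hr.le]
      exact hr')
    rw [add_sub_cancel] at h2
    simpa [Q] using h2
  rw [integral_add (integrable_haarT (by fun_prop)) (integrable_haarT (by fun_prop)),
    integral_re' (integrable_haarT (by fun_prop)), integral_eval_circle] at h1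
  simpa [Q] using h1

lemma poisson_davis (s : ℝ) (h : Polynomial ℂ) {ρ : ℝ} (h0 : 0 ≤ ρ) (h1 : ρ < 1) (φ : Tor) :
    ∫ θ, pker ρ (θ - φ) * Real.sqrt (s ^ 2 + ‖h.eval (uexp θ) - h.eval (ρ * uexp φ)‖ ^ 2 +
        ‖h.eval (uexp θ)‖ ^ 2) ∂haarT ≤
      Real.sqrt (s ^ 2 + ‖h.eval (ρ * uexp φ)‖ ^ 2) +
      8 * (∫ θ, pker ρ (θ - φ) * ‖h.eval (uexp θ)‖ ∂haarT - ‖h.eval (ρ * uexp φ)‖) := by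
  have hP : Continuous fun θ => pker ρ (θ - φ) :=
    (continuous_pker h0 h1).comp (continuous_id.sub continuous_const)
  have h := (locSubMean_davis s (h.eval (ρ * uexp φ)) h).le_poisson
    (by unfold davis; fun_prop) h0 h1 φ
  simp only [davis, mul_sub, sub_self, norm_zero] at h
  rw [integral_sub (integrable_haarT (by fun_prop)) (integrable_haarT (by fun_prop))] at h
  simp_rw [mul_left_comm _ (8 : ℝ) _] at h
  rw [integral_const_mul] at h
  simp only [ne_eq, OfNat.ofNat_ne_zero, not_false_eq_true, zero_pow, add_zero] at h
  linarith

lemma integrable_prod_haarT {F : Tor × Tor → ℝ} (hF : Continuous F) :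
    Integrable F (haarT.prod haarT) :=
  hF.integrable_of_hasCompactSupport (HasCompactSupport.of_compactSpace F)

lemma integral_haarT_swap {F : Tor → Tor → ℝ} (hF : Continuous fun p : Tor × Tor => F p.1 p.2) :
    ∫ θ, ∫ φ, F θ φ ∂haarT ∂haarT = ∫ φ, ∫ θ, F θ φ ∂haarT ∂haarT :=
  integral_integral_swap (integrable_prod_haarT hF)

lemma integral_pker_right {ρ : ℝ} (h0 : 0 ≤ ρ) (h1 : ρ < 1) (θ : Tor) :
    ∫ φ, pker ρ (θ - φ) ∂haarT = 1 := by
  simp_rw [pker_comm ρ θ]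
  exact integral_pker h0 h1 θ

lemma integral_pker_eval_right {ρ : ℝ} (h0 : 0 ≤ ρ) (h1 : ρ < 1) (θ : Tor) (Q : Polynomial ℂ) :
    ∫ φ, (pker ρ (θ - φ) : ℂ) * Q.eval (uexp φ) ∂haarT = Q.eval (ρ * uexp θ) := by
  simp_rw [pker_comm ρ θ]
  exact integral_pker_eval h0 h1 θ Q

@[fun_prop]
lemma continuous_integral_haarT {X : Type*} [TopologicalSpace X] [FirstCountableTopology X]
    [LocallyCompactSpace X] {F : X → Tor → ℝ}
    (hF : Continuous fun p : X × Tor => F p.1 p.2) : Continuous fun x => ∫ φ, F x φ ∂haarT := by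
  simpa using continuous_parametric_integral_of_continuous (μ := haarT) hF isCompact_univ

/-- The integrand in the one-step estimate. -/
def stepInt {ι : Type*} [Fintype ι] (V : ι → Polynomial ℂ) (h : Polynomial ℂ) (ρ : ℝ)
    (θ φ : Tor) : ℝ :=
  pker ρ (θ - φ) * Real.sqrt ((l2 fun i => (V i).eval (uexp φ)) ^ 2 +
    ‖h.eval (uexp θ) - h.eval (ρ * uexp φ)‖ ^ 2 + ‖h.eval (uexp θ)‖ ^ 2)

lemma continuous_stepInt {ι : Type*} [Fintype ι] (V : ι → Polynomial ℂ) (h : Polynomial ℂ)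
    {ρ : ℝ} (h0 : 0 ≤ ρ) (h1 : ρ < 1) : Continuous fun p : Tor × Tor => stepInt V h ρ p.1 p.2 := by
  have hP2 : Continuous fun p : Tor × Tor => pker ρ (p.1 - p.2) :=
    (continuous_pker h0 h1).comp (continuous_fst.sub continuous_snd)
  unfold stepInt
  fun_prop

lemma sqrt_le_integral_stepInt {ι : Type*} [Fintype ι] (V : ι → Polynomial ℂ)
    (h : Polynomial ℂ) {ρ : ℝ} (h0 : 0 ≤ ρ) (h1 : ρ < 1) {K : Tor → ℂ} (hK : Continuous K)
    (hKP : ∀ s, ‖K s‖ ≤ pker ρ s) (θ : Tor) :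
    Real.sqrt (∑ i, ‖(V i).eval (ρ * uexp θ)‖ ^ 2 +
      ‖∫ φ, K (θ - φ) * (h.eval (uexp θ) - h.eval (ρ * uexp φ)) ∂haarT‖ ^ 2 +
      ‖h.eval (uexp θ)‖ ^ 2) ≤ ∫ φ, stepInt V h ρ θ φ ∂haarT := by
  have hPθ : Continuous fun φ => pker ρ (θ - φ) :=
    (continuous_pker h0 h1).comp (continuous_const.sub continuous_id)
  have hKθ : Continuous fun φ => K (θ - φ) := hK.comp (continuous_const.sub continuous_id)
  let F : Tor → Option (Option ι) → ℂ := fun φ o =>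
    o.elim (K (θ - φ) * (h.eval (uexp θ) - h.eval (ρ * uexp φ))) fun o' =>
      (pker ρ (θ - φ) : ℂ) * o'.elim (h.eval (uexp θ)) fun i => (V i).eval (uexp φ)
  have hFc : ∀ o, Continuous fun φ => F φ o := by
    rintro (_ | _ | i) <;> simp only [F, Option.elim] <;> fun_prop
  have hF := l2_integral_le (μ := haarT) (F := F) fun o => integrable_haarT (hFc o)
  have hl : l2 (fun o => ∫ φ, F φ o ∂haarT) = Real.sqrt (∑ i, ‖(V i).eval (ρ * uexp θ)‖ ^ 2 +
      ‖∫ φ, K (θ - φ) * (h.eval (uexp θ) - h.eval (ρ * uexp φ)) ∂haarT‖ ^ 2 +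
      ‖h.eval (uexp θ)‖ ^ 2) := by
    unfold l2
    rw [Fintype.sum_option, Fintype.sum_option]
    simp only [F, Option.elim]
    rw [integral_mul_const, integral_complex_ofReal, integral_pker_right h0 h1]
    simp_rw [integral_pker_eval_right h0 h1]
    congr 1
    push_cast
    rw [one_mul]
    ring
  rw [← hl]
  have hSθ : Continuous fun φ => stepInt V h ρ θ φ :=
    by unfold stepInt; fun_prop
  have hlF : Continuous fun φ => l2 (F φ) := continuous_l2 hFc
  refine hF.trans (integral_mono (integrable_haarT hlF) (integrable_haarT hSθ) fun φ => ?_)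
  have hp := pker_nonneg h0 h1 (θ - φ)
  simp only [stepInt]
  rw [← Real.sqrt_sq hp, ← Real.sqrt_mul (sq_nonneg _)]
  refine Real.sqrt_le_sqrt ?_
  rw [Fintype.sum_option, Fintype.sum_option]
  simp only [F, Option.elim, norm_mul, mul_pow, l2_sq, Complex.norm_real, Real.norm_eq_abs, sq_abs,
    ← Finset.mul_sum]
  have : ‖K (θ - φ)‖ ^ 2 ≤ pker ρ (θ - φ) ^ 2 := by
    gcongr; exact hKP _
  nlinarith [mul_le_mul_of_nonneg_right this
    (sq_nonneg ‖h.eval (uexp θ) - h.eval (ρ * uexp φ)‖)]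

/-- Passing from radius `ρ` to radius `1` and adding one new component. -/
lemma step_estimate {ι : Type*} [Fintype ι] (V : ι → Polynomial ℂ) (h : Polynomial ℂ) {ρ : ℝ}
    (h0 : 0 ≤ ρ) (h1 : ρ < 1) {K : Tor → ℂ} (hK : Continuous K) (hKP : ∀ s, ‖K s‖ ≤ pker ρ s)
    {D : Tor → ℂ} (hDc : Continuous D)
    (hD : ∀ θ, D θ = ∫ φ, K (θ - φ) * (h.eval (uexp θ) - h.eval (ρ * uexp φ)) ∂haarT) :
    ∫ θ, Real.sqrt (∑ i, ‖(V i).eval (ρ * uexp θ)‖ ^ 2 + ‖D θ‖ ^ 2 + ‖h.eval (uexp θ)‖ ^ 2) ∂haarT ≤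
      ∫ θ, Real.sqrt (∑ i, ‖(V i).eval (uexp θ)‖ ^ 2 + ‖h.eval (ρ * uexp θ)‖ ^ 2) ∂haarT +
      8 * (∫ θ, ‖h.eval (uexp θ)‖ ∂haarT - ∫ θ, ‖h.eval (ρ * uexp θ)‖ ∂haarT) := by
  have hP := continuous_pker h0 h1
  have hP2 : Continuous fun p : Tor × Tor => pker ρ (p.1 - p.2) :=
    hP.comp (continuous_fst.sub continuous_snd)
  have hS := continuous_stepInt V h h0 h1
  have hpt := fun θ => sqrt_le_integral_stepInt V h h0 h1 hK hKP θ
  simp_rw [← hD] at hpt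
  have hS' : Continuous fun p : Tor × Tor => stepInt V h ρ p.2 p.1 := by
    have hP3 : Continuous fun p : Tor × Tor => pker ρ (p.2 - p.1) :=
      hP.comp (continuous_snd.sub continuous_fst)
    unfold stepInt
    fun_prop
  have hN : Continuous fun p : Tor × Tor => pker ρ (p.1 - p.2) * ‖h.eval (uexp p.1)‖ := by
    fun_prop
  have hN' : Continuous fun p : Tor × Tor => pker ρ (p.2 - p.1) * ‖h.eval (uexp p.2)‖ := by
    have hP3 : Continuous fun p : Tor × Tor => pker ρ (p.2 - p.1) :=
      hP.comp (continuous_snd.sub continuous_fst)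
    fun_prop
  have hNφ : Continuous fun φ => ∫ θ, pker ρ (θ - φ) * ‖h.eval (uexp θ)‖ ∂haarT :=
    continuous_integral_haarT (F := fun φ θ => pker ρ (θ - φ) * ‖h.eval (uexp θ)‖) hN'
  have hSi : Continuous fun φ => ∫ θ, stepInt V h ρ θ φ ∂haarT :=
    continuous_integral_haarT (F := fun φ θ => stepInt V h ρ θ φ) hS'
  calc _ ≤ ∫ θ, ∫ φ, stepInt V h ρ θ φ ∂haarT ∂haarT :=
        integral_mono (integrable_haarT (by fun_prop))
          (integrable_haarT (continuous_integral_haarT hS)) hpt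
    _ = ∫ φ, ∫ θ, stepInt V h ρ θ φ ∂haarT ∂haarT := integral_haarT_swap hS
    _ ≤ ∫ φ, (Real.sqrt ((l2 fun i => (V i).eval (uexp φ)) ^ 2 + ‖h.eval (ρ * uexp φ)‖ ^ 2) +
          8 * (∫ θ, pker ρ (θ - φ) * ‖h.eval (uexp θ)‖ ∂haarT - ‖h.eval (ρ * uexp φ)‖)) ∂haarT :=
        integral_mono (integrable_haarT hSi) (integrable_haarT (by fun_prop))
          fun φ => poisson_davis _ h h0 h1 φ
    _ = _ := by
      rw [integral_add (integrable_haarT (by fun_prop)) (integrable_haarT (by fun_prop)),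
        integral_const_mul, integral_sub (integrable_haarT hNφ) (integrable_haarT (by fun_prop)),
        ← integral_haarT_swap
        (F := fun θ φ => pker ρ (θ - φ) * ‖h.eval (uexp θ)‖) hN]
      simp_rw [integral_mul_const, integral_pker_right h0 h1, one_mul, l2_sq]

/-! ### The square function estimate along a chain of radii -/

lemma l2_contraction {ι : Type*} [Fintype ι] (V : ι → Polynomial ℂ) {ρ : ℝ}
    (h0 : 0 ≤ ρ) (h1 : ρ < 1) :
    ∫ θ, l2 (fun i => (V i).eval (ρ * uexp θ)) ∂haarT ≤
      ∫ θ, l2 (fun i => (V i).eval (uexp θ)) ∂haarT := by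
  have := step_estimate V 0 h0 h1 (K := fun _ => 0) (D := fun _ => 0) continuous_const
    (fun s => by simpa using pker_nonneg h0 h1 s) continuous_const (fun θ => by simp)
  simpa [l2] using this

lemma norm_contraction (g : Polynomial ℂ) {ρ : ℝ} (h0 : 0 ≤ ρ) (h1 : ρ < 1) :
    ∫ θ, ‖g.eval (ρ * uexp θ)‖ ∂haarT ≤ ∫ θ, ‖g.eval (uexp θ)‖ ∂haarT := by
  have := l2_contraction (fun _ : Unit => g) h0 h1
  simpa [l2] using this

/-- A step `D` of the chain, from radius `r` to radius `r'`, for the polynomial `g`. -/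
def IsStep (g D : Polynomial ℂ) (r r' : ℝ) : Prop :=
  (r < r' ∧ ∃ K : Tor → ℂ, Continuous K ∧ (∀ s, ‖K s‖ ≤ pker (r / r') s) ∧
    ∀ θ, D.eval (uexp θ) =
      ∫ φ, K (θ - φ) * (g.eval (r' * uexp θ) - g.eval (r * uexp φ)) ∂haarT) ∨
  (r = r' ∧ D = 0)

lemma chain_estimate (g : Polynomial ℂ) {r : ℕ → ℝ} (hr0 : ∀ l, 0 < r l) (D : ℕ → Polynomial ℂ)
    (n : ℕ) (hD : ∀ l < n, IsStep g (D l) (r l) (r (l + 1))) :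
    ∫ θ, Real.sqrt (∑ l ∈ Finset.range n, ‖(D l).eval ((r (l + 1) / r n : ℝ) * uexp θ)‖ ^ 2 +
        ‖g.eval (r n * uexp θ)‖ ^ 2) ∂haarT ≤
      8 * ∫ θ, ‖g.eval (r n * uexp θ)‖ ∂haarT := by
  suffices h : ∫ θ, Real.sqrt (∑ l ∈ Finset.range n,
      ‖(D l).eval ((r (l + 1) / r n : ℝ) * uexp θ)‖ ^ 2 +
        ‖g.eval (r n * uexp θ)‖ ^ 2) ∂haarT ≤
      ∫ θ, ‖g.eval (r 0 * uexp θ)‖ ∂haarT +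
      8 * (∫ θ, ‖g.eval (r n * uexp θ)‖ ∂haarT - ∫ θ, ‖g.eval (r 0 * uexp θ)‖ ∂haarT) by
    have : 0 ≤ ∫ θ, ‖g.eval (r 0 * uexp θ)‖ ∂haarT := integral_nonneg fun _ => norm_nonneg _
    linarith
  induction n with
  | zero => simp
  | succ n ih =>
    have ih := ih fun l hl => hD l (Nat.lt_succ_of_lt hl)
    rcases hD n n.lt_succ_self with ⟨hlt, K, hK, hKP, hDe⟩ | ⟨heq, hz⟩
    · have hn := hr0 n
      have hn' := hr0 (n + 1)
      have hne : (r n : ℂ) ≠ 0 := by exact_mod_cast hn.ne'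
      have hne' : (r (n + 1) : ℂ) ≠ 0 := by exact_mod_cast hn'.ne'
      have h := step_estimate
        (fun l : Fin n => (D l).comp (Polynomial.C ((r (l + 1) / r n : ℝ) : ℂ) * Polynomial.X))
        (g.comp (Polynomial.C (r (n + 1) : ℂ) * Polynomial.X)) (ρ := r n / r (n + 1))
        (by positivity) ((div_lt_one hn').2 hlt) hK hKP (D := fun θ => (D n).eval (uexp θ))
        (by fun_prop) (fun θ => by
          rw [hDe θ]
          refine integral_congr_ae (.of_forall fun φ => ?_)
          simp only [Polynomial.eval_comp, Polynomial.eval_mul, Polynomial.eval_C,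
            Polynomial.eval_X]
          rw [← mul_assoc (r (n + 1) : ℂ)]
          congr 4
          push_cast
          field_simp)
      simp only [Polynomial.eval_comp, Polynomial.eval_mul, Polynomial.eval_C,
            Polynomial.eval_X, ← mul_assoc] at h
      have e1 : (r (n + 1) : ℂ) * ((r n / r (n + 1) : ℝ) : ℂ) = r n := by
        push_cast; field_simp
      have e2 : ∀ l, (((r (l + 1) / r n : ℝ) : ℂ)) * ((r n / r (n + 1) : ℝ) : ℂ) =
          ((r (l + 1) / r (n + 1) : ℝ) : ℂ) := by
        intro l; push_cast; field_simp
      simp only [e1, e2] at h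
      simp_rw [fun θ => Fin.sum_univ_eq_sum_range
        (fun l => ‖(D l).eval (((r (l + 1) / r n : ℝ) : ℂ) * uexp θ)‖ ^ 2) n,
        fun θ => Fin.sum_univ_eq_sum_range
        (fun l => ‖(D l).eval (((r (l + 1) / r (n + 1) : ℝ) : ℂ) * uexp θ)‖ ^ 2) n] at h
      simp_rw [Finset.sum_range_succ]
      rw [div_self hn'.ne', ofReal_one]
      simp_rw [one_mul]
      linarith
    · simp_rw [Finset.sum_range_succ, ← heq, hz]
      simpa using ih

lemma chain_estimate_boundary (g : Polynomial ℂ) {r : ℕ → ℝ} (hr0 : ∀ l, 0 < r l)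
    (hr1 : ∀ l, r l < 1) (D : ℕ → Polynomial ℂ)
    (n : ℕ) (hD : ∀ l < n, IsStep g (D l) (r l) (r (l + 1))) :
    ∫ θ, Real.sqrt (∑ l ∈ Finset.range n, ‖(D l).eval (r (l + 1) * uexp θ)‖ ^ 2) ∂haarT ≤
      8 * ∫ θ, ‖g.eval (uexp θ)‖ ∂haarT := by
  have hne : (r n : ℂ) ≠ 0 := by exact_mod_cast (hr0 n).ne'
  have h1 := chain_estimate g hr0 D n hD
  have h2 := norm_contraction g (hr0 n).le (hr1 n)
  have h3 := l2_contraction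
    (fun l : Fin n => (D l).comp (Polynomial.C ((r (l + 1) / r n : ℝ) : ℂ) * Polynomial.X))
    (hr0 n).le (hr1 n)
  have e2 : ∀ l, (((r (l + 1) / r n : ℝ) : ℂ)) * (r n : ℂ) = (r (l + 1) : ℂ) := by
    intro l; push_cast; field_simp
  simp only [l2, Polynomial.eval_comp, Polynomial.eval_mul, Polynomial.eval_C,
            Polynomial.eval_X, ← mul_assoc, e2] at h3
  simp_rw [fun θ => Fin.sum_univ_eq_sum_range
        (fun l => ‖(D l).eval (((r (l + 1) / r n : ℝ) : ℂ) * uexp θ)‖ ^ 2) n,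
        fun θ => Fin.sum_univ_eq_sum_range
        (fun l => ‖(D l).eval (r (l + 1) * uexp θ)‖ ^ 2) n] at h3
  have h4 : ∫ θ, Real.sqrt (∑ l ∈ Finset.range n,
      ‖(D l).eval ((r (l + 1) / r n : ℝ) * uexp θ)‖ ^ 2) ∂haarT ≤
      ∫ θ, Real.sqrt (∑ l ∈ Finset.range n, ‖(D l).eval ((r (l + 1) / r n : ℝ) * uexp θ)‖ ^ 2 +
        ‖g.eval (r n * uexp θ)‖ ^ 2) ∂haarT :=
    integral_mono (integrable_haarT (by fun_prop)) (integrable_haarT (by fun_prop)) fun θ =>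
      Real.sqrt_le_sqrt (le_add_of_nonneg_right (sq_nonneg _))
  linarith

/-! ### Multipliers acting on polynomials -/

/-- The polynomial with coefficients `m n * g.coeff n`. -/
def pmul (m : ℕ → ℝ) (g : Polynomial ℂ) : Polynomial ℂ :=
  ∑ n ∈ g.support, Polynomial.monomial n (m n * g.coeff n)

@[simp]
lemma coeff_pmul (m : ℕ → ℝ) (g : Polynomial ℂ) (n : ℕ) :
    (pmul m g).coeff n = m n * g.coeff n := by
  simp only [pmul, Polynomial.finsetSum_coeff, Polynomial.coeff_monomial, Finset.sum_ite_eq',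
    Polynomial.mem_support_iff]
  split_ifs with h
  · rfl
  · simp [not_not.1 h]

lemma eval_pmul (m : ℕ → ℝ) (g : Polynomial ℂ) (z : ℂ) :
    (pmul m g).eval z = ∑ n ∈ g.support, m n * g.coeff n * z ^ n := by
  simp [pmul, Polynomial.eval_finsetSum]

lemma eval_pmul_mul (m : ℕ → ℝ) (g : Polynomial ℂ) (r : ℝ) (z : ℂ) :
    (pmul m g).eval (r * z) = (pmul (fun n => m n * r ^ n) g).eval z := by
  simp only [eval_pmul]
  refine Finset.sum_congr rfl fun n _ => ?_
  push_cast
  ring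

lemma pmul_one (g : Polynomial ℂ) : pmul (fun _ => 1) g = g := by ext; simp

lemma eval_mul_eq_pmul (g : Polynomial ℂ) (r : ℝ) (z : ℂ) :
    g.eval (r * z) = (pmul (fun n => r ^ n) g).eval z := by
  conv_lhs => rw [← pmul_one g]
  rw [eval_pmul_mul]
  simp

/-- `K` acts on analytic polynomials by convolution as the multiplier `κ`. -/
def HasMult (K : Tor → ℂ) (κ : ℕ → ℝ) : Prop :=
  Continuous K ∧ ∀ (n : ℕ) θ, ∫ φ, K (θ - φ) * uexp φ ^ n ∂haarT = κ n * uexp θ ^ n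

lemma HasMult.integral_eval {K : Tor → ℂ} {κ : ℕ → ℝ} (h : HasMult K κ) (g : Polynomial ℂ)
    (θ : Tor) : ∫ φ, K (θ - φ) * g.eval (uexp φ) ∂haarT = (pmul κ g).eval (uexp θ) := by
  have hK := h.1
  have e : ∀ φ, K (θ - φ) * g.eval (uexp φ) =
      ∑ n ∈ g.support, g.coeff n * (K (θ - φ) * uexp φ ^ n) := by
    intro φ
    rw [Polynomial.eval_eq_sum, Polynomial.sum_def, Finset.mul_sum]
    exact Finset.sum_congr rfl fun n _ => by ring
  simp_rw [e]
  rw [integral_finsetSum _ fun n _ => integrable_haarT (by fun_prop), eval_pmul]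
  simp_rw [integral_const_mul, h.2]
  exact Finset.sum_congr rfl fun n _ => by ring

lemma HasMult.isStep {K : Tor → ℂ} {κ : ℕ → ℝ} (h : HasMult K κ) (g : Polynomial ℂ) {r r' : ℝ}
    (hr : r < r') (hKP : ∀ s, ‖K s‖ ≤ pker (r / r') s) :
    IsStep g (pmul (fun n => κ 0 * r' ^ n - κ n * r ^ n) g) r r' := by
  refine .inl ⟨hr, K, h.1, hKP, fun θ => ?_⟩
  have hK := h.1
  simp_rw [mul_sub]
  rw [integral_sub (integrable_haarT (by fun_prop)) (integrable_haarT (by fun_prop)),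
    integral_mul_const]
  have h0 := h.2 0 θ
  simp only [pow_zero, mul_one] at h0
  simp_rw [h0, eval_mul_eq_pmul, h.integral_eval, eval_pmul, coeff_pmul]
  rw [Finset.mul_sum]
  have hs : (pmul (fun n => r ^ n) g).support ⊆ g.support := by
    intro n hn
    simp only [Polynomial.mem_support_iff, coeff_pmul] at hn ⊢
    exact right_ne_zero_of_mul hn
  rw [Finset.sum_subset hs (by
      intro n _ hn
      simp only [Polynomial.mem_support_iff, coeff_pmul, not_not] at hn
      rw [hn]; simp), ← Finset.sum_sub_distrib]
  refine Finset.sum_congr rfl fun n _ => ?_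
  push_cast
  ring

/-! ### Fejér kernels and the multipliers built from them -/

/-- `N` times the Fejér kernel of order `N`. -/
def fejer (N : ℕ) (s : Tor) : ℝ := ‖∑ j ∈ Finset.range N, uexp s ^ j‖ ^ 2

@[fun_prop]
lemma continuous_fejer (N : ℕ) : Continuous (fejer N) := by unfold fejer; fun_prop

lemma fejer_nonneg (N : ℕ) (s : Tor) : 0 ≤ fejer N s := by unfold fejer; positivity

lemma fejer_eq_sum (N : ℕ) (s : Tor) : (fejer N s : ℂ) =
    ∑ j ∈ Finset.range N, ∑ k ∈ Finset.range N, uexp s ^ ((j : ℤ) - k) := by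
  rw [fejer, Complex.ofReal_pow, ← Complex.mul_conj', map_sum, Finset.sum_mul_sum]
  refine Finset.sum_congr rfl fun j _ => Finset.sum_congr rfl fun k _ => ?_
  rw [map_pow, conj_uexp, zpow_sub₀ (uexp_ne_zero s), inv_pow, zpow_natCast, zpow_natCast,
    div_eq_mul_inv]

lemma sum_sum_sub {a : ℤ → ℂ} (ha : ∀ n < 0, a n = 0) (N : ℕ) :
    ∑ j ∈ Finset.range N, ∑ k ∈ Finset.range N, a ((j : ℤ) - k) =
      ∑ n ∈ Finset.range N, ((N - n : ℕ) : ℂ) * a n := by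
  induction N with
  | zero => simp
  | succ N ih =>
    have h1 : ∀ j ∈ Finset.range N, ∑ k ∈ Finset.range (N + 1), a ((j : ℤ) - k) =
        ∑ k ∈ Finset.range N, a ((j : ℤ) - k) := by
      intro j hj
      rw [Finset.sum_range_succ, ha _ (by have := Finset.mem_range.1 hj; omega), add_zero]
    have h2 : ∑ k ∈ Finset.range (N + 1), a ((N : ℤ) - k) =
        ∑ n ∈ Finset.range (N + 1), a n := by
      rw [← Finset.sum_range_reflect]
      refine Finset.sum_congr rfl fun n hn => ?_
      have := Finset.mem_range.1 hn
      congr 1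
      omega
    have h3 : ∑ n ∈ Finset.range (N + 1), ((N + 1 - n : ℕ) : ℂ) * a n =
        ∑ n ∈ Finset.range (N + 1), (((N - n : ℕ) : ℂ) * a n + a n) := by
      refine Finset.sum_congr rfl fun n hn => ?_
      have := Finset.mem_range.1 hn
      rw [show N + 1 - n = (N - n) + 1 by omega]
      push_cast
      ring
    rw [Finset.sum_range_succ, Finset.sum_congr rfl h1, ih, h2, h3, Finset.sum_add_distrib,
      Finset.sum_range_succ (fun n => ((N - n : ℕ) : ℂ) * a n)]
    simp

lemma fourierCoeff_eq (g : Tor → ℂ) (n : ℤ) :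
    fourierCoeff g n = ∫ φ, uexp φ ^ (-n) * g φ ∂haarT := by
  simp only [fourierCoeff, fourier_eq_uexp_zpow, smul_eq_mul]
  rfl

lemma continuous_uexp_zpow (n : ℤ) : Continuous fun s => uexp s ^ n :=
  continuous_uexp.zpow₀ n fun s => .inl (uexp_ne_zero s)

lemma integrable_mul_of_continuous {K g : Tor → ℂ} (hK : Continuous K) (hg : Integrable g haarT) :
    Integrable (fun φ => K φ * g φ) haarT := by
  obtain ⟨C, hC⟩ := (isCompact_range hK).isBounded.exists_norm_le
  exact hg.bdd_mul hK.aestronglyMeasurable (.of_forall fun φ => hC _ ⟨φ, rfl⟩)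

lemma fejer_conv {g : Tor → ℂ} (hg : Integrable g haarT) (hg0 : ∀ n < 0, fourierCoeff g n = 0)
    (N : ℕ) (θ : Tor) : ∫ φ, (fejer N (θ - φ) : ℂ) * g φ ∂haarT =
      ∑ n ∈ Finset.range N, ((N - n : ℕ) : ℂ) * (fourierCoeff g n * uexp θ ^ n) := by
  have h1 : ∀ m : ℤ, ∫ φ, uexp (θ - φ) ^ m * g φ ∂haarT = fourierCoeff g m * uexp θ ^ m := by
    intro m
    rw [fourierCoeff_eq, ← integral_mul_const]
    refine integral_congr_ae (.of_forall fun φ => ?_)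
    simp only [uexp_sub, div_zpow, zpow_neg]
    ring
  have hi : ∀ m : ℤ, Integrable (fun φ => uexp (θ - φ) ^ m * g φ) haarT := fun m =>
    integrable_mul_of_continuous
      ((continuous_uexp_zpow m).comp (continuous_const.sub continuous_id)) hg
  have h2 := sum_sum_sub (a := fun m => fourierCoeff g m * uexp θ ^ m)
    (fun n hn => by simp [hg0 n hn]) N
  simp only [zpow_natCast] at h2
  rw [← h2]
  simp_rw [fejer_eq_sum, Finset.sum_mul]
  rw [integral_finsetSum _ fun j _ => integrable_finsetSum _ fun k _ => hi _]
  refine Finset.sum_congr rfl fun j _ => ?_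
  rw [integral_finsetSum _ fun k _ => hi _]
  exact Finset.sum_congr rfl fun k _ => h1 _

lemma fourierCoeff_uexp_pow (n : ℕ) (m : ℤ) :
    fourierCoeff (fun φ => uexp φ ^ n) m = if m = n then 1 else 0 := by
  rw [fourierCoeff_eq]
  have : ∀ φ, uexp φ ^ (-m) * uexp φ ^ n = uexp φ ^ (n - m) := by
    intro φ
    rw [← zpow_natCast, ← zpow_add₀ (uexp_ne_zero φ)]
    congr 1
    ring
  simp_rw [this, integral_uexp_zpow]
  congr 1
  rw [sub_eq_zero]
  exact propext eq_comm

lemma hasMult_fejer (N : ℕ) : HasMult (fun s => (fejer N s : ℂ)) fun n => ((N - n : ℕ) : ℝ) := by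
  refine ⟨by fun_prop, fun n θ => ?_⟩
  rw [fejer_conv (integrable_haarT (by fun_prop)) (fun m hm => by
    rw [fourierCoeff_uexp_pow, if_neg]; omega)]
  simp_rw [fourierCoeff_uexp_pow]
  simp only [Nat.cast_inj, ite_mul, one_mul, zero_mul, mul_ite, mul_zero, Finset.sum_ite_eq',
    Finset.mem_range]
  split_ifs with h
  · simp
  · simp [Nat.sub_eq_zero_of_le (not_lt.1 h)]

lemma hasMult_pker {ρ : ℝ} (h0 : 0 ≤ ρ) (h1 : ρ < 1) :
    HasMult (fun s => (pker ρ s : ℂ)) fun n => ρ ^ n := by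
  have := continuous_pker h0 h1
  refine ⟨by fun_prop, fun n θ => ?_⟩
  have := integral_pker_eval_right h0 h1 θ (Polynomial.X ^ n)
  simpa [mul_pow] using this

lemma HasMult.add {K K' : Tor → ℂ} {κ κ' : ℕ → ℝ} (h : HasMult K κ) (h' : HasMult K' κ') :
    HasMult (fun s => K s + K' s) fun n => κ n + κ' n := by
  refine ⟨h.1.add h'.1, fun n θ => ?_⟩
  have hK := h.1
  have hK' := h'.1
  simp_rw [add_mul]
  rw [integral_add (integrable_haarT (by fun_prop)) (integrable_haarT (by fun_prop)), h.2, h'.2]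
  push_cast
  ring

lemma HasMult.const_mul {K : Tor → ℂ} {κ : ℕ → ℝ} (h : HasMult K κ) (c : ℝ) :
    HasMult (fun s => c * K s) fun n => c * κ n := by
  refine ⟨continuous_const.mul h.1, fun n θ => ?_⟩
  simp_rw [mul_assoc]
  rw [integral_const_mul, h.2]
  push_cast
  ring

lemma HasMult.sum {ι : Type*} (s : Finset ι) {K : ι → Tor → ℂ} {κ : ι → ℕ → ℝ}
    (h : ∀ i ∈ s, HasMult (K i) (κ i)) :
    HasMult (fun t => ∑ i ∈ s, K i t) fun n => ∑ i ∈ s, κ i n := by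
  refine ⟨continuous_finsetSum _ fun i hi => (h i hi).1, fun n θ => ?_⟩
  simp_rw [Finset.sum_mul]
  rw [integral_finsetSum _ fun i hi => ?_]
  · push_cast
    rw [Finset.sum_mul]
    exact Finset.sum_congr rfl fun i hi => (h i hi).2 n θ
  · have := (h i hi).1
    exact integrable_haarT (by fun_prop)

lemma fejer_le_sq (N : ℕ) (s : Tor) : fejer N s ≤ (N : ℝ) ^ 2 := by
  unfold fejer
  gcongr
  refine (norm_sum_le _ _).trans ?_
  simp

lemma fejer_mul_le (N : ℕ) (s : Tor) : fejer N s * ‖1 - uexp s‖ ^ 2 ≤ 4 := by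
  rw [fejer, ← mul_pow, ← norm_mul, geom_sum_mul_neg]
  have : ‖1 - uexp s ^ N‖ ≤ 2 := by
    refine (norm_sub_le _ _).trans ?_
    simp
    norm_num
  nlinarith [norm_nonneg (1 - uexp s ^ N)]

lemma norm_sq_one_sub_mul (q : ℝ) (s : Tor) :
    ‖1 - q * uexp s‖ ^ 2 = (1 - q) ^ 2 + q * ‖1 - uexp s‖ ^ 2 := by
  have h1 : ‖uexp s‖ ^ 2 = 1 := by simp
  rw [Complex.sq_norm, Complex.normSq_apply] at h1
  simp only [Complex.sq_norm, Complex.normSq_apply, Complex.sub_re, Complex.mul_re,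
    Complex.ofReal_re, Complex.ofReal_im, Complex.sub_im, Complex.mul_im, Complex.one_re,
    Complex.one_im]
  linear_combination (q ^ 2 - q) * h1

lemma fejer_le_pker {M N : ℕ} (hM : 1 ≤ M) (hN : N ≤ 4 * M) (s : Tor) :
    fejer N s ≤ 40 * M * pker (Real.exp (-1 / M)) s := by
  have hM' : (1 : ℝ) ≤ M := by exact_mod_cast hM
  have hM0 : (0 : ℝ) < M := by linarith
  set q := Real.exp (-1 / M) with hq
  have hq0 : 0 < q := Real.exp_pos _
  have hq1 : q < 1 := Real.exp_lt_one_iff.2 (div_neg_of_neg_of_pos (by norm_num) hM0)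
  have h1 : (1 - q) * M ≤ 1 := by
    have := Real.add_one_le_exp (-1 / (M : ℝ))
    rw [← hq] at this
    have h2 : -1 / (M : ℝ) * M = -1 := by field_simp
    nlinarith
  have h2 : 1 ≤ 2 * M * (1 - q ^ 2) := by
    have h3 : (1 + 2 / (M : ℝ)) * q ^ 2 ≤ 1 := by
      have := Real.add_one_le_exp (2 / (M : ℝ))
      have h4 : q ^ 2 = (Real.exp (2 / M))⁻¹ := by
        rw [hq, ← Real.exp_nat_mul, ← Real.exp_neg]; congr 1; push_cast; ring
      rw [h4, ← div_eq_mul_inv, div_le_one (Real.exp_pos _)]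
      linarith
    have h5 : (M + 2) * q ^ 2 ≤ M := by
      have : (M : ℝ) * ((1 + 2 / (M : ℝ)) * q ^ 2) = (M + 2) * q ^ 2 := by field_simp
      nlinarith
    nlinarith
  have hpos : 0 < ‖1 - (q : ℂ) * uexp s‖ ^ 2 := by
    have := one_sub_mul_uexp_ne_zero hq0.le hq1 s
    positivity
  have hNM : (N : ℝ) ≤ 4 * M := by exact_mod_cast hN
  have h6 : fejer N s * ‖1 - (q : ℂ) * uexp s‖ ^ 2 ≤ 20 := by
    rw [norm_sq_one_sub_mul]
    have ha := fejer_le_sq N s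
    have hb := fejer_mul_le N s
    have hc := fejer_nonneg N s
    have hd : fejer N s * (1 - q) ^ 2 ≤ 16 := by
      calc fejer N s * (1 - q) ^ 2 ≤ (4 * M) ^ 2 * (1 - q) ^ 2 := by
            gcongr
            exact ha.trans (by gcongr)
        _ = 16 * ((1 - q) * M) ^ 2 := by ring
        _ ≤ 16 * 1 ^ 2 := by
          have : 0 ≤ (1 - q) * M := mul_nonneg (by linarith) hM0.le
          gcongr
        _ = 16 := by norm_num
    have he : q * (fejer N s * ‖1 - uexp s‖ ^ 2) ≤ 1 * 4 := by
      have : 0 ≤ fejer N s * ‖1 - uexp s‖ ^ 2 := by positivity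
      gcongr
    nlinarith
  rw [pker, ← mul_div_assoc, le_div_iff₀ hpos]
  nlinarith

lemma exists_lowpass_kernel {M : ℕ} (hM : 1 ≤ M) : ∃ K κ, HasMult K κ ∧
    (∀ s, ‖K s‖ ≤ 41 * pker (Real.exp (-1 / M)) s) ∧ κ 0 = 0 ∧
    ∀ n : ℕ, κ n = ((M - n : ℕ) : ℝ) / M - Real.exp (-1 / M) ^ n := by
  have hM' : (1 : ℝ) ≤ M := by exact_mod_cast hM
  have hM0 : (0 : ℝ) < M := by linarith
  have hq0 : 0 < Real.exp (-1 / M) := Real.exp_pos _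
  have hq1 : Real.exp (-1 / M) < 1 :=
    Real.exp_lt_one_iff.2 (div_neg_of_neg_of_pos (by norm_num) hM0)
  refine ⟨_, _, ((hasMult_fejer M).const_mul (1 / M)).add
    ((hasMult_pker hq0.le hq1).const_mul (-1)), fun s => ?_, ?_, fun n => ?_⟩
  · have h1 := fejer_le_pker hM (by omega : M ≤ 4 * M) s
    have h2 := fejer_nonneg M s
    have h3 := pker_nonneg hq0.le hq1 s
    have h4 : 1 / (M : ℝ) * fejer M s ≤ 40 * pker (Real.exp (-1 / M)) s := by
      rw [one_div, inv_mul_le_iff₀ hM0]; linarith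
    rw [← Complex.ofReal_mul, ← Complex.ofReal_mul, ← Complex.ofReal_add, Complex.norm_real,
      Real.norm_eq_abs, abs_le]
    have h5 : 0 ≤ 1 / (M : ℝ) * fejer M s := by positivity
    constructor <;> linarith
  · simp; field_simp; ring
  · ring

/-- Second-order summation by parts for a geometric progression. -/
lemma pow_eq_sum_tent (R : ℝ) (L n : ℕ) (hn : n ≤ L + 1) :
    R ^ n = ∑ i ∈ Finset.range L, (R - 1) ^ 2 * R ^ i * ((i + 1 - n : ℕ) : ℝ) +
      (R ^ L - R ^ (L + 1)) * ((L + 1 - n : ℕ) : ℝ) + R ^ (L + 1) := by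
  induction L with
  | zero =>
    interval_cases n <;> simp
  | succ L ih =>
    rcases Nat.lt_or_ge (L + 1) n with h | h
    · have : n = L + 2 := by omega
      subst this
      rw [Finset.sum_eq_zero]
      · simp
      · intro i hi
        have := Finset.mem_range.1 hi
        rw [Nat.sub_eq_zero_of_le (by omega)]
        simp
    · rw [Finset.sum_range_succ]
      have ih := ih h
      rw [Nat.cast_sub h] at *
      rw [Nat.cast_sub (by omega : n ≤ L + 1 + 1)]
      push_cast at *
      rw [ih]
      ring

/-- The absolute constant in the estimate of the high-pass kernels. -/
def highConst : ℝ := 720 * Real.exp 12 + 120 * Real.exp 9 + 80 * Real.exp 6 + 40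

lemma exists_highpass_kernel {M : ℕ} (hM : 1 ≤ M) : ∃ K κ, HasMult K κ ∧
    (∀ s, ‖K s‖ ≤ highConst * pker (Real.exp (-1 / M)) s) ∧ κ 0 = 0 ∧
    ∀ n ≤ 2 * M, κ n = Real.exp (3 / M) ^ n - ((M - n : ℕ) : ℝ) / M := by
  have hM' : (1 : ℝ) ≤ M := by exact_mod_cast hM
  have hM0 : (0 : ℝ) < M := by linarith
  have hq0 : 0 < Real.exp (-1 / M) := Real.exp_pos _
  have hq1 : Real.exp (-1 / M) < 1 :=
    Real.exp_lt_one_iff.2 (div_neg_of_neg_of_pos (by norm_num) hM0)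
  set R := Real.exp (3 / M) with hR
  have hR1 : 1 ≤ R := Real.one_le_exp (by positivity)
  obtain ⟨L, hL⟩ : ∃ L, 2 * M = L + 1 := ⟨2 * M - 1, by omega⟩
  have hκ := (((HasMult.sum (Finset.range L) fun i _ =>
    (hasMult_fejer (i + 1)).const_mul ((R - 1) ^ 2 * R ^ i)).add
    ((hasMult_fejer (L + 1)).const_mul (R ^ L - R ^ (L + 1)))).add
    (((hasMult_fejer (4 * M)).const_mul (R ^ (L + 1) / M)).add
    ((hasMult_fejer (3 * M)).const_mul (-(R ^ (L + 1) / M))))).add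
    ((hasMult_fejer M).const_mul (-(1 / M)))
  have hval : ∀ n ≤ 2 * M, _ = R ^ n - ((M - n : ℕ) : ℝ) / M := fun n hn => by
    have h1 := pow_eq_sum_tent R L n (by omega)
    have h2 : R ^ (L + 1) = R ^ (L + 1) / M * ((4 * M - n : ℕ) : ℝ) +
        -(R ^ (L + 1) / M) * ((3 * M - n : ℕ) : ℝ) := by
      rw [Nat.cast_sub (by omega), Nat.cast_sub (by omega)]
      push_cast
      field_simp
      ring
    have h3 : ∑ i ∈ Finset.range L, (R - 1) ^ 2 * R ^ i * ((i + 1 - n : ℕ) : ℝ) +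
      (R ^ L - R ^ (L + 1)) * ((L + 1 - n : ℕ) : ℝ) +
      (R ^ (L + 1) / M * ((4 * M - n : ℕ) : ℝ) +
        -(R ^ (L + 1) / M) * ((3 * M - n : ℕ) : ℝ)) + -(1 / M) * ((M - n : ℕ) : ℝ) =
        R ^ n - ((M - n : ℕ) : ℝ) / M := by
      rw [← h2, ← h1]; ring
    exact h3
  refine ⟨_, _, hκ, fun s => ?_, ?_, hval⟩
  · set p := pker (Real.exp (-1 / M)) s with hp
    have hp0 : 0 ≤ p := pker_nonneg hq0.le hq1 s
    have hF : ∀ N ≤ 4 * M, ∀ c b : ℝ, |c| ≤ b / M →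
        ‖(c : ℂ) * (fejer N s : ℂ)‖ ≤ b * 40 * p := by
      intro N hN c b hc
      rw [← Complex.ofReal_mul, Complex.norm_real, Real.norm_eq_abs, abs_mul,
        abs_of_nonneg (fejer_nonneg N s)]
      calc |c| * fejer N s ≤ b / M * (40 * M * p) := by
            have := fejer_nonneg N s
            have hb : 0 ≤ b / M := (abs_nonneg c).trans hc
            gcongr
            exact fejer_le_pker hM hN s
        _ = b * 40 * p := by field_simp
    have hRL : R ^ (L + 1) = Real.exp 6 := by
      rw [← hL, hR, ← Real.exp_nat_mul]; congr 1; push_cast; field_simp; norm_num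
    have hRi : ∀ i ≤ L + 1, R ^ i ≤ Real.exp 6 := fun i hi =>
      hRL ▸ pow_le_pow_right₀ hR1 hi
    have hR3 : R - 1 ≤ 3 * Real.exp 3 / M := by
      have h1 : R - 1 ≤ 3 / M * R := by
        have := Real.add_one_le_exp (-(3 / (M : ℝ)))
        rw [Real.exp_neg, ← hR] at this
        have h2 : R⁻¹ * R = 1 := inv_mul_cancel₀ (by linarith)
        nlinarith
      have h2 : R ≤ Real.exp 3 := by
        rw [hR]; gcongr; rw [div_le_iff₀ hM0]; linarith
      calc R - 1 ≤ 3 / M * R := h1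
        _ ≤ 3 / M * Real.exp 3 := by gcongr
        _ = _ := by ring
    have hR0 : 0 ≤ R - 1 := by linarith
    have b1 : ‖∑ i ∈ Finset.range L, (((R - 1) ^ 2 * R ^ i : ℝ) : ℂ) * (fejer (i + 1) s : ℂ)‖ ≤
        720 * Real.exp 12 * p := by
      calc _ ≤ ∑ i ∈ Finset.range L, 9 * Real.exp 12 / M * 40 * p := by
            refine norm_sum_le_of_le _ fun i hi => ?_
            have hi' := Finset.mem_range.1 hi
            refine hF _ (by omega) _ _ ?_
            rw [abs_of_nonneg (by positivity)]
            calc (R - 1) ^ 2 * R ^ i ≤ (3 * Real.exp 3 / M) ^ 2 * Real.exp 6 := by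
                  gcongr
                  exact hRi _ (by omega)
              _ = _ := by
                rw [div_pow, mul_pow, ← Real.exp_nat_mul]
                have : Real.exp 12 = Real.exp ((2 : ℕ) * 3) * Real.exp 6 := by
                  rw [← Real.exp_add]; norm_num
                rw [this]
                field_simp
                norm_num
        _ = (L : ℝ) * (9 * Real.exp 12 / M * 40 * p) := by simp
        _ ≤ (2 * M) * (9 * Real.exp 12 / M * 40 * p) := by
          gcongr
          exact_mod_cast (by omega : L ≤ 2 * M)
        _ = _ := by field_simp; ring
    have b2 := hF (L + 1) (by omega) (R ^ L - R ^ (L + 1)) (3 * Real.exp 9) (by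
      rw [show R ^ L - R ^ (L + 1) = -(R ^ L * (R - 1)) by ring, abs_neg,
        abs_of_nonneg (by positivity)]
      calc R ^ L * (R - 1) ≤ Real.exp 6 * (3 * Real.exp 3 / M) := by
            gcongr
            exact hRi _ (by omega)
        _ = _ := by
          have : Real.exp 9 = Real.exp 6 * Real.exp 3 := by rw [← Real.exp_add]; norm_num
          rw [this]; ring)
    have b3 := hF (4 * M) le_rfl (R ^ (L + 1) / M) (Real.exp 6) (by
      rw [hRL, abs_of_nonneg (by positivity)])
    have b4 := hF (3 * M) (by omega) (-(R ^ (L + 1) / M)) (Real.exp 6) (by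
      rw [hRL, abs_neg, abs_of_nonneg (by positivity)])
    have b5 := hF M (by omega) (-(1 / M)) 1 (by
      rw [abs_neg, abs_of_nonneg (by positivity)])
    refine (norm_add_le_of_le (norm_add_le_of_le (norm_add_le_of_le b1 b2)
      (norm_add_le_of_le b3 b4)) b5).trans (le_of_eq ?_)
    rw [highConst]
    ring
  · refine (hval 0 (Nat.zero_le _)).trans ?_
    simp [hM0.ne']

/-! ### Dyadic square functions -/

/-- The dyadic radii `exp (-2 / 2 ^ k)`. -/
def rad (k : ℕ) : ℝ := Real.exp (-2 / 2 ^ k)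

lemma rad_pos (k : ℕ) : 0 < rad k := Real.exp_pos _

lemma rad_lt_one (k : ℕ) : rad k < 1 :=
  Real.exp_lt_one_iff.2 (div_neg_of_neg_of_pos (by norm_num) (by positivity))

lemma rad_strictMono : StrictMono rad := by
  refine strictMono_nat_of_lt_succ fun k => Real.exp_lt_exp.2 ?_
  rw [pow_succ, neg_div, neg_div, neg_lt_neg_iff]
  gcongr
  have : (0 : ℝ) < 2 ^ k := by positivity
  linarith

lemma rad_eq (k : ℕ) : rad k = Real.exp (-1 / (2 ^ k : ℕ)) ^ 2 := by
  rw [rad, ← Real.exp_nat_mul]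
  congr 1
  push_cast
  ring

lemma rad_succ (k : ℕ) : rad (k + 1) = Real.exp (-1 / (2 ^ k : ℕ)) := by
  rw [rad]
  congr 1
  push_cast
  field_simp
  ring

/-- The `L¹` norm of a polynomial on the unit circle. -/
def polyNorm (g : Polynomial ℂ) : ℝ := ∫ θ, ‖g.eval (uexp θ)‖ ∂haarT

lemma polyNorm_nonneg (g : Polynomial ℂ) : 0 ≤ polyNorm g :=
  integral_nonneg fun _ => norm_nonneg _

lemma pmul_const_mul (c : ℝ) (m : ℕ → ℝ) (g : Polynomial ℂ) :
    pmul (fun n => c * m n) g = Polynomial.C (c : ℂ) * pmul m g := by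
  ext n
  simp [mul_assoc]

lemma pmul_add (m m' : ℕ → ℝ) (g : Polynomial ℂ) :
    pmul (fun n => m n + m' n) g = pmul m g + pmul m' g := by
  ext n
  simp [add_mul]

lemma pmul_sub (m m' : ℕ → ℝ) (g : Polynomial ℂ) :
    pmul (fun n => m n - m' n) g = pmul m g - pmul m' g := by
  ext n
  simp [sub_mul]

lemma pmul_pmul (m m' : ℕ → ℝ) (g : Polynomial ℂ) :
    pmul m (pmul m' g) = pmul (fun n => m n * m' n) g := by
  ext n
  simp [mul_assoc]

lemma integral_dyadic_square_le {K : ℕ → Tor → ℂ} {κ : ℕ → ℕ → ℝ} {C : ℝ} (hC : 0 < C)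
    (hK : ∀ k, HasMult (K k) (κ k))
    (hb : ∀ k s, ‖K k s‖ ≤ C * pker (Real.exp (-1 / (2 ^ k : ℕ))) s) (h0 : ∀ k, κ k 0 = 0)
    (g : Polynomial ℂ) (n : ℕ) :
    ∫ θ, Real.sqrt (∑ k ∈ Finset.range n,
      ‖(pmul (fun m => rad (k + 1) ^ (3 * m) * κ k m) g).eval (uexp θ)‖ ^ 2) ∂haarT ≤
      C * (8 * polyNorm g) := by
  have hstep : ∀ k, IsStep g (pmul (fun m => C⁻¹ * κ k 0 * rad (k + 1) ^ m -
      C⁻¹ * κ k m * rad k ^ m) g) (rad k) (rad (k + 1)) := by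
    intro k
    refine ((hK k).const_mul C⁻¹).isStep g (rad_strictMono k.lt_succ_self) fun s => ?_
    have hq : rad k / rad (k + 1) = Real.exp (-1 / (2 ^ k : ℕ)) := by
      rw [rad_eq, rad_succ]
      field_simp
    rw [hq, norm_mul, Complex.norm_real, Real.norm_eq_abs, abs_of_pos (inv_pos.2 hC),
      inv_mul_le_iff₀ hC]
    exact hb k s
  have h1 := chain_estimate_boundary g rad_pos rad_lt_one _ n fun l _ => hstep l
  have h2 : ∀ k θ, (pmul (fun m => rad (k + 1) ^ (3 * m) * κ k m) g).eval (uexp θ) =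
      -C * (pmul (fun m => C⁻¹ * κ k 0 * rad (k + 1) ^ m -
      C⁻¹ * κ k m * rad k ^ m) g).eval (rad (k + 1) * uexp θ) := by
    intro k θ
    have h3 : (fun m => rad (k + 1) ^ (3 * m) * κ k m) = fun m => -C *
        ((C⁻¹ * κ k 0 * rad (k + 1) ^ m - C⁻¹ * κ k m * rad k ^ m) * rad (k + 1) ^ m) := by
      funext m
      rw [h0, rad_eq k, rad_succ]
      field_simp
      ring
    rw [eval_pmul_mul, h3, pmul_const_mul]
    simp
  have h3 : ∀ θ, Real.sqrt (∑ k ∈ Finset.range n,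
      ‖(pmul (fun m => rad (k + 1) ^ (3 * m) * κ k m) g).eval (uexp θ)‖ ^ 2) =
      C * Real.sqrt (∑ k ∈ Finset.range n, ‖(pmul (fun m => C⁻¹ * κ k 0 * rad (k + 1) ^ m -
      C⁻¹ * κ k m * rad k ^ m) g).eval (rad (k + 1) * uexp θ)‖ ^ 2) := by
    intro θ
    simp_rw [h2, norm_mul, norm_neg, Complex.norm_real, Real.norm_eq_abs, mul_pow, sq_abs,
      ← Finset.mul_sum]
    rw [Real.sqrt_mul (sq_nonneg C), Real.sqrt_sq hC.le]
  simp_rw [h3]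
  rw [integral_const_mul]
  gcongr
  exact h1

lemma integral_difference_square_le {k : ℕ → ℕ} (hk : Monotone k) (g : Polynomial ℂ) (n : ℕ) :
    ∫ θ, Real.sqrt (∑ j ∈ Finset.range n,
      ‖(pmul (fun m => rad (k (j + 1)) ^ (2 * m)) g).eval (uexp θ) -
        (pmul (fun m => rad (k j) ^ (2 * m)) g).eval (uexp θ)‖ ^ 2) ∂haarT ≤
      8 * polyNorm g := by
  have hstep : ∀ j, IsStep g (pmul (fun m => rad (k (j + 1)) ^ m -
      (rad (k j) / rad (k (j + 1))) ^ m * rad (k j) ^ m) g) (rad (k j)) (rad (k (j + 1))) := by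
    intro j
    rcases (hk j.le_succ).eq_or_lt with h | h
    · refine .inr ⟨congrArg rad h, ?_⟩
      have := (rad_pos (k (j + 1))).ne'
      ext m
      simp [show k (j + 1) = k j from h.symm, (rad_pos (k j)).ne']
    · have hlt : rad (k j) < rad (k (j + 1)) := rad_strictMono h
      have h0 : 0 ≤ rad (k j) / rad (k (j + 1)) := (div_pos (rad_pos _) (rad_pos _)).le
      have h1 : rad (k j) / rad (k (j + 1)) < 1 := (div_lt_one (rad_pos _)).2 hlt
      have := (hasMult_pker h0 h1).isStep g hlt fun s => by
        rw [Complex.norm_real, Real.norm_eq_abs, abs_of_nonneg (pker_nonneg h0 h1 s)]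
      simpa using this
  have h1 := chain_estimate_boundary g (fun j => rad_pos (k j)) (fun j => rad_lt_one (k j)) _ n
    fun l _ => hstep l
  refine le_of_eq_of_le ?_ h1
  congr 1
  funext θ
  congr 1
  refine Finset.sum_congr rfl fun j _ => ?_
  have := (rad_pos (k (j + 1))).ne'
  rw [eval_pmul_mul, ← Polynomial.eval_sub, ← pmul_sub]
  congr 4
  funext m
  rw [div_pow]
  field_simp
  ring

/-! ### Sharp truncations -/

/-- The sum of the monomials of degree less than `N`. -/
def lowPart (N : ℕ) (g : Polynomial ℂ) : Polynomial ℂ := pmul (fun n => if n < N then 1 else 0) g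

lemma eval_lowPart (N : ℕ) (g : Polynomial ℂ) (z : ℂ) :
    (lowPart N g).eval z = ∑ n ∈ g.support with n < N, g.coeff n * z ^ n := by
  rw [lowPart, eval_pmul, Finset.sum_filter]
  refine Finset.sum_congr rfl fun n _ => ?_
  split_ifs <;> simp

lemma weak_lowPart {ι : Type*} [Fintype ι] (f : ι → Polynomial ℂ) (N : ι → ℕ) {α : ℝ}
    (hα : 0 < α) :
    α * haarT.real {θ | α < l2 fun i => (lowPart (N i) (f i)).eval (uexp θ)} ≤
      ∫ θ, l2 (fun i => (f i).eval (uexp θ)) ∂haarT := by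
  let b : ι → Polynomial ℂ := fun i => ∑ n ∈ (f i).support with n < N i,
    Polynomial.monomial (N i - n) ((starRingEnd ℂ) ((f i).coeff n))
  let a : ι → Polynomial ℂ := fun i => ∑ n ∈ (f i).support with ¬ n < N i,
    Polynomial.monomial (n - N i) ((f i).coeff n)
  have hb : ∀ i, (b i).eval 0 = 0 := by
    intro i
    simp only [b, Polynomial.eval_finsetSum, Polynomial.eval_monomial]
    refine Finset.sum_eq_zero fun n hn => ?_
    have := (Finset.mem_filter.1 hn).2
    rw [zero_pow (by omega), mul_zero]
  have hconj : ∀ i θ, uexp θ ^ N i * (starRingEnd ℂ) ((b i).eval (uexp θ)) =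
      (lowPart (N i) (f i)).eval (uexp θ) := by
    intro i θ
    simp only [b, Polynomial.eval_finsetSum, Polynomial.eval_monomial, map_sum, map_mul, map_pow,
      Complex.conj_conj, conj_uexp, eval_lowPart, Finset.mul_sum]
    refine Finset.sum_congr rfl fun n hn => ?_
    have h := (Finset.mem_filter.1 hn).2
    have := uexp_ne_zero θ
    rw [← Nat.sub_add_cancel h.le, pow_add, Nat.sub_add_cancel h.le, inv_pow]
    field_simp
  have hfull : ∀ i θ, uexp θ ^ N i * ((a i).eval (uexp θ) +
      (starRingEnd ℂ) ((b i).eval (uexp θ))) = (f i).eval (uexp θ) := by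
    intro i θ
    rw [mul_add, hconj, eval_lowPart, Polynomial.eval_eq_sum (p := f i), Polynomial.sum_def,
      ← Finset.sum_filter_add_sum_filter_not (f i).support (fun n => n < N i), add_comm]
    congr 1
    simp only [a, Polynomial.eval_finsetSum, Polynomial.eval_monomial, Finset.mul_sum]
    refine Finset.sum_congr rfl fun n hn => ?_
    have h := not_lt.1 (Finset.mem_filter.1 hn).2
    rw [mul_left_comm, ← pow_add, Nat.add_sub_cancel' h]
  have h1 : ∀ θ, l2 (fun i => (b i).eval (uexp θ)) =
      l2 fun i => (lowPart (N i) (f i)).eval (uexp θ) := by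
    intro θ
    simp_rw [l2, ← hconj, norm_mul, norm_pow, norm_uexp, one_pow, one_mul, RCLike.norm_conj]
  have h2 : ∀ θ, sumNorm a b (uexp θ) = l2 fun i => (f i).eval (uexp θ) := by
    intro θ
    simp_rw [sumNorm, l2, ← hfull, norm_mul, norm_pow, norm_uexp, one_pow, one_mul]
  have := weak_conj a b hb hα
  simpa only [h1, h2] using this

/-! ### Lacunary sequences -/

lemma ratio_mul_le {Λ : ℕ → ℕ} (h0 : ∀ j, 0 < Λ j) (j : ℕ) : ratio Λ * Λ j ≤ Λ (j + 1) := by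
  have hj : (0 : ℝ) < Λ j := by exact_mod_cast h0 j
  rw [← le_div_iff₀ hj]
  exact ciInf_le (f := fun j => (Λ (j + 1) : ℝ) / Λ j)
    ⟨0, by rintro _ ⟨i, rfl⟩; positivity⟩ j

lemma ratio_pow_mul_le {Λ : ℕ → ℕ} (h0 : ∀ j, 0 < Λ j) (h1 : 1 < ratio Λ) (j m : ℕ) :
    ratio Λ ^ m * Λ j ≤ Λ (j + m) := by
  induction m with
  | zero => simp
  | succ m ih =>
    calc ratio Λ ^ (m + 1) * Λ j = ratio Λ * (ratio Λ ^ m * Λ j) := by ring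
      _ ≤ ratio Λ * Λ (j + m) := by gcongr
      _ ≤ Λ (j + (m + 1)) := ratio_mul_le h0 (j + m)

lemma card_log_fiber_le {Λ : ℕ → ℕ} (h0 : ∀ j, 0 < Λ j) (h1 : 1 < ratio Λ) (h2 : ratio Λ < 2)
    (n k : ℕ) : (((Finset.range n).filter fun j => Nat.log 2 (Λ j) = k).card : ℝ) ≤
      2 / (ratio Λ - 1) := by
  set s := (Finset.range n).filter fun j => Nat.log 2 (Λ j) = k with hs
  have hpos : 0 < ratio Λ - 1 := by linarith
  rcases s.eq_empty_or_nonempty with he | hne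
  · rw [he]
    simp only [Finset.card_empty, Nat.cast_zero]
    positivity
  set i := s.min' hne with hi
  set j := s.max' hne with hj
  have hij : i ≤ j := s.min'_le_max' hne
  have hik : Nat.log 2 (Λ i) = k := (Finset.mem_filter.1 (s.min'_mem hne)).2
  have hjk : Nat.log 2 (Λ j) = k := (Finset.mem_filter.1 (s.max'_mem hne)).2
  have hcard : s.card ≤ j - i + 1 := by
    have : s ⊆ Finset.Icc i j := fun x hx =>
      Finset.mem_Icc.2 ⟨s.min'_le x hx, s.le_max' x hx⟩
    have := Finset.card_le_card this
    rw [Nat.card_Icc] at this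
    omega
  have hlow : (2 : ℝ) ^ k ≤ Λ i := by
    exact_mod_cast hik ▸ Nat.pow_log_le_self 2 (h0 i).ne'
  have hupp : (Λ j : ℝ) < 2 ^ (k + 1) := by
    exact_mod_cast hjk ▸ Nat.lt_pow_succ_log_self one_lt_two (Λ j)
  have hgrow := ratio_pow_mul_le h0 h1 i (j - i)
  rw [Nat.add_sub_cancel' hij] at hgrow
  have hbern := one_add_mul_le_pow (by linarith : (-2 : ℝ) ≤ ratio Λ - 1) (j - i)
  rw [add_sub_cancel] at hbern
  have hk : (0 : ℝ) < 2 ^ k := by positivity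
  have hR : ratio Λ ^ (j - i) < 2 := by
    have : ratio Λ ^ (j - i) * 2 ^ k ≤ ratio Λ ^ (j - i) * Λ i := by gcongr
    rw [pow_succ] at hupp
    nlinarith
  have hc : (s.card : ℝ) ≤ (j - i : ℕ) + 1 := by exact_mod_cast hcard
  rw [le_div_iff₀ hpos]
  nlinarith

lemma sum_comp_le {k : ℕ → ℕ} {n : ℕ} {N : ℝ}
    (hN : ∀ i, (((Finset.range n).filter fun j => k j = i).card : ℝ) ≤ N) {F : ℕ → ℝ}
    (hF : ∀ i, 0 ≤ F i) {L : ℕ} (hL : ∀ j < n, k j < L) :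
    ∑ j ∈ Finset.range n, F (k j) ≤ N * ∑ i ∈ Finset.range L, F i := by
  rw [← Finset.sum_fiberwise_of_maps_to (t := Finset.range L) (g := k)
    (fun j hj => Finset.mem_range.2 (hL j (Finset.mem_range.1 hj))), Finset.mul_sum]
  refine Finset.sum_le_sum fun i _ => ?_
  rw [Finset.sum_congr rfl fun j hj => by rw [(Finset.mem_filter.1 hj).2], Finset.sum_const,
    nsmul_eq_mul]
  exact mul_le_mul_of_nonneg_right (hN i) (hF i)

/-! ### The weak-type estimate for polynomials -/

/-- The increments of a sequence, starting from the value `0`. -/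
def incr (u : ℕ → ℂ) (j : ℕ) : ℂ := if j = 0 then u 0 else u j - u (j - 1)

lemma incr_zero (u : ℕ → ℂ) : incr u 0 = u 0 := rfl

lemma incr_succ (u : ℕ → ℂ) (j : ℕ) : incr u (j + 1) = u (j + 1) - u j := rfl

lemma incr_add (u v : ℕ → ℂ) (j : ℕ) : incr (fun i => u i + v i) j = incr u j + incr v j := by
  unfold incr
  split_ifs <;> ring

lemma sqrt_sum_range (n : ℕ) (u : ℕ → ℂ) :
    Real.sqrt (∑ j ∈ Finset.range n, ‖u j‖ ^ 2) = l2 fun j : Fin n => u j := by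
  rw [l2, Fin.sum_univ_eq_sum_range (fun j => ‖u j‖ ^ 2)]

lemma l2_incr_le (n : ℕ) (u : ℕ → ℂ) :
    l2 (fun j : Fin (n + 1) => incr u j) ≤ 2 * l2 fun j : Fin (n + 1) => u j := by
  have h1 : ∀ j : Fin (n + 1), incr u j = u j - if (j : ℕ) = 0 then 0 else u (j - 1) := by
    intro j
    unfold incr
    split_ifs with h <;> simp [h]
  simp_rw [h1]
  refine (l2_sub_le _ _).trans ?_
  have h2 : l2 (fun j : Fin (n + 1) => if (j : ℕ) = 0 then 0 else u (j - 1)) ≤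
      l2 fun j : Fin (n + 1) => u j := by
    refine l2_mono ?_
    rw [Fin.sum_univ_succ, Fin.sum_univ_castSucc]
    simp
  linarith

lemma l2_incr_le_add (n : ℕ) (u : ℕ → ℂ) :
    l2 (fun j : Fin (n + 1) => incr u j) ≤
      ‖u 0‖ + Real.sqrt (∑ j ∈ Finset.range n, ‖u (j + 1) - u j‖ ^ 2) := by
  rw [l2, Fin.sum_univ_succ, Fin.sum_univ_eq_sum_range (fun j => ‖u (j + 1) - u j‖ ^ 2) n |>.symm]
  refine (Real.sqrt_le_left (by positivity)).2 ?_
  have h := Real.sq_sqrt (Finset.sum_nonneg (s := Finset.univ) fun (j : Fin n) _ =>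
    sq_nonneg ‖u (j + 1) - u j‖)
  have h' : 0 ≤ ‖u 0‖ * Real.sqrt (∑ j : Fin n, ‖u (j + 1) - u j‖ ^ 2) := by positivity
  simp only [Fin.val_zero, incr_zero, Fin.val_succ, incr_succ]
  nlinarith

lemma l2_incr_add_le (n : ℕ) (x y p : ℕ → ℂ) :
    l2 (fun j : Fin (n + 1) => incr (fun i => x i + y i + p i) j) ≤
      ‖p 0‖ + Real.sqrt (∑ j ∈ Finset.range n, ‖p (j + 1) - p j‖ ^ 2) +
        2 * Real.sqrt (∑ j ∈ Finset.range (n + 1), ‖y j‖ ^ 2) +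
        2 * l2 fun j : Fin (n + 1) => x j := by
  simp_rw [incr_add (fun i => x i + y i) p, incr_add x y]
  have h1 := l2_add_le (fun j : Fin (n + 1) => incr x j + incr y j) fun j => incr p j
  have h2 := l2_add_le (fun j : Fin (n + 1) => incr x j) fun j => incr y j
  have h3 := l2_incr_le n x
  have h4 := l2_incr_le n y
  have h5 := l2_incr_le_add n p
  rw [sqrt_sum_range (n + 1)]
  linarith

lemma lowPart_eq {κA κB : ℕ → ℕ → ℝ}
    (hA : ∀ k, ∀ n ≤ 2 * 2 ^ k, κA k n =
      Real.exp (3 / (2 ^ k : ℕ)) ^ n - ((2 ^ k - n : ℕ) : ℝ) / (2 ^ k : ℕ))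
    (hB : ∀ k n, κB k n =
      ((2 ^ k - n : ℕ) : ℝ) / (2 ^ k : ℕ) - Real.exp (-1 / (2 ^ k : ℕ)) ^ n)
    {N : ℕ} (hN : 0 < N) {k : ℕ} (hk : Nat.log 2 N = k) (g : Polynomial ℂ) :
    lowPart N g = lowPart N (pmul (fun m => rad (k + 1) ^ (3 * m) * κA k m) g) +
      pmul (fun m => rad (k + 1) ^ (3 * m) * κB k m) g + pmul (fun m => rad k ^ (2 * m)) g := by
  subst hk
  set k := Nat.log 2 N
  have h1 : 2 ^ k ≤ N := Nat.pow_log_le_self 2 hN.ne'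
  have h2 : N < 2 ^ (k + 1) := Nat.lt_pow_succ_log_self one_lt_two N
  rw [lowPart, lowPart, pmul_pmul, ← pmul_add, ← pmul_add]
  congr 1
  funext n
  have hq : rad k ^ (2 * n) = rad (k + 1) ^ (3 * n) * rad (k + 1) ^ n := by
    rw [rad_eq k, rad_succ]
    ring
  have he : rad (k + 1) ^ (3 * n) * Real.exp (3 / (2 ^ k : ℕ)) ^ n = 1 := by
    rw [pow_mul, ← mul_pow, rad_succ, ← Real.exp_nat_mul, ← Real.exp_add]
    have : ((3 : ℕ) : ℝ) * (-1 / (2 ^ k : ℕ)) + 3 / (2 ^ k : ℕ) = 0 := by push_cast; ring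
    rw [this, Real.exp_zero, one_pow]
  rw [hB, hq, ← rad_succ]
  split_ifs with h
  · rw [hA k n (by rw [pow_succ] at h2; omega)]
    linear_combination -he
  · rw [Nat.sub_eq_zero_of_le (by omega : 2 ^ k ≤ n)]
    push_cast
    ring

/-- The absolute constant in the weak-type estimate. -/
def weakConst : ℝ := 1330 + 32 * highConst

lemma highConst_pos : 0 < highConst := by unfold highConst; positivity

lemma weakConst_pos : 0 < weakConst := by
  have := highConst_pos
  unfold weakConst
  positivity

lemma integral_lacunary_square_le {F : ℕ → Polynomial ℂ} {C : ℝ}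
    (hF : ∀ L, ∫ θ, Real.sqrt (∑ i ∈ Finset.range L, ‖(F i).eval (uexp θ)‖ ^ 2) ∂haarT ≤ C)
    {k : ℕ → ℕ} {n : ℕ} {N : ℝ} (hN0 : 0 ≤ N)
    (hN : ∀ i, (((Finset.range n).filter fun j => k j = i).card : ℝ) ≤ N) :
    ∫ θ, Real.sqrt (∑ j ∈ Finset.range n, ‖(F (k j)).eval (uexp θ)‖ ^ 2) ∂haarT ≤
      Real.sqrt N * C := by
  obtain ⟨L, hL⟩ : ∃ L, ∀ j < n, k j < L :=
    ⟨(Finset.range n).sup k + 1, fun j hj =>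
      Nat.lt_succ_of_le (Finset.le_sup (f := k) (Finset.mem_range.2 hj))⟩
  calc _ ≤ ∫ θ, Real.sqrt N *
        Real.sqrt (∑ i ∈ Finset.range L, ‖(F i).eval (uexp θ)‖ ^ 2) ∂haarT := by
        refine integral_mono (integrable_haarT (by fun_prop)) (integrable_haarT (by fun_prop))
          fun θ => ?_
        rw [← Real.sqrt_mul hN0]
        exact Real.sqrt_le_sqrt (sum_comp_le (F := fun i => ‖(F i).eval (uexp θ)‖ ^ 2) hN
          (fun i => sq_nonneg _) hL)
    _ ≤ Real.sqrt N * C := by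
        rw [integral_const_mul]
        exact mul_le_mul_of_nonneg_left (hF L) (Real.sqrt_nonneg _)

lemma weak_polynomial {Λ : ℕ → ℕ} (hΛ : StrictMono Λ) (h0 : 0 < Λ 0) (h1 : 1 < ratio Λ)
    (h2 : ratio Λ < 2) (g : Polynomial ℂ) (n : ℕ) {α : ℝ} (hα : 0 < α) :
    α * haarT.real {θ | α < l2 fun j : Fin (n + 1) =>
      incr (fun i => (lowPart (Λ i) g).eval (uexp θ)) j} ≤
      weakConst * Real.sqrt (2 / (ratio Λ - 1)) * polyNorm g := by
  have hpos : ∀ j, 0 < Λ j := fun j => h0.trans_le (hΛ.monotone j.zero_le)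
  have hρ : 0 < ratio Λ - 1 := by linarith
  set N := 2 / (ratio Λ - 1) with hN
  have hN1 : 1 ≤ Real.sqrt N := by
    rw [Real.one_le_sqrt, hN, one_le_div hρ]
    linarith
  have hN0 : 0 ≤ N := by positivity
  choose KA κA hmA hbA hA0 hA using fun k : ℕ => exists_highpass_kernel (Nat.one_le_two_pow (n := k))
  choose KB κB hmB hbB hB0 hB using fun k : ℕ => exists_lowpass_kernel (Nat.one_le_two_pow (n := k))
  let k : ℕ → ℕ := fun j => Nat.log 2 (Λ j)
  have hk : Monotone k := fun i j hij => Nat.log_mono_right (hΛ.monotone hij)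
  let A : ℕ → Polynomial ℂ := fun k => pmul (fun m => rad (k + 1) ^ (3 * m) * κA k m) g
  let B : ℕ → Polynomial ℂ := fun k => pmul (fun m => rad (k + 1) ^ (3 * m) * κB k m) g
  let P : ℕ → Polynomial ℂ := fun k => pmul (fun m => rad k ^ (2 * m)) g
  have hcard : ∀ i, (((Finset.range (n + 1)).filter fun j => k j = i).card : ℝ) ≤ N := fun i =>
    card_log_fiber_le hpos h1 h2 (n + 1) i
  have iA : ∫ θ, Real.sqrt (∑ j ∈ Finset.range (n + 1), ‖(A (k j)).eval (uexp θ)‖ ^ 2) ∂haarT ≤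
      Real.sqrt N * (highConst * (8 * polyNorm g)) :=
    integral_lacunary_square_le
      (fun L => integral_dyadic_square_le highConst_pos hmA hbA hA0 g L) hN0 hcard
  have iB : ∫ θ, Real.sqrt (∑ j ∈ Finset.range (n + 1), ‖(B (k j)).eval (uexp θ)‖ ^ 2) ∂haarT ≤
      Real.sqrt N * (41 * (8 * polyNorm g)) :=
    integral_lacunary_square_le
      (fun L => integral_dyadic_square_le (by norm_num) hmB hbB hB0 g L) hN0 hcard
  have iP : ∫ θ, Real.sqrt (∑ j ∈ Finset.range n,
      ‖(P (k (j + 1))).eval (uexp θ) - (P (k j)).eval (uexp θ)‖ ^ 2) ∂haarT ≤ 8 * polyNorm g :=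
    integral_difference_square_le hk g n
  have i0 : ∫ θ, ‖(P (k 0)).eval (uexp θ)‖ ∂haarT ≤ polyNorm g := by
    have := norm_contraction g (ρ := rad (k 0) ^ 2) (sq_nonneg _)
      (pow_lt_one₀ (rad_pos _).le (rad_lt_one _) two_ne_zero)
    simp_rw [eval_mul_eq_pmul, ← pow_mul] at this
    exact this
  let T : Tor → ℝ := fun θ => ‖(P (k 0)).eval (uexp θ)‖ + Real.sqrt (∑ j ∈ Finset.range n,
      ‖(P (k (j + 1))).eval (uexp θ) - (P (k j)).eval (uexp θ)‖ ^ 2) +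
      2 * Real.sqrt (∑ j ∈ Finset.range (n + 1), ‖(B (k j)).eval (uexp θ)‖ ^ 2)
  have hTc : Continuous T := by fun_prop
  have hT0 : ∀ θ, 0 ≤ T θ := fun θ => by positivity
  have hT : ∫ θ, T θ ∂haarT ≤ (9 + 656 * Real.sqrt N) * polyNorm g := by
    have e : ∫ θ, T θ ∂haarT = _ := integral_add
      (f := fun θ => ‖(P (k 0)).eval (uexp θ)‖ + Real.sqrt (∑ j ∈ Finset.range n,
        ‖(P (k (j + 1))).eval (uexp θ) - (P (k j)).eval (uexp θ)‖ ^ 2))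
      (integrable_haarT (by fun_prop)) (integrable_haarT (by fun_prop))
    rw [e, integral_add (integrable_haarT (by fun_prop)) (integrable_haarT (by fun_prop)),
      integral_const_mul]
    linarith
  have hweak := weak_lowPart (fun j : Fin (n + 1) => A (k j)) (fun j => Λ j)
    (by positivity : 0 < α / 4)
  have hl2 : ∀ θ, l2 (fun j : Fin (n + 1) => (A (k j)).eval (uexp θ)) =
      Real.sqrt (∑ j ∈ Finset.range (n + 1), ‖(A (k j)).eval (uexp θ)‖ ^ 2) := fun θ =>
    (sqrt_sum_range (n + 1) fun j => (A (k j)).eval (uexp θ)).symm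
  simp_rw [hl2] at hweak
  have hmarkov : α / 2 * haarT.real {θ | α / 2 ≤ T θ} ≤ ∫ θ, T θ ∂haarT :=
    mul_meas_ge_le_integral_of_nonneg (.of_forall hT0) (integrable_haarT hTc) _
  have hsub : {θ | α < l2 fun j : Fin (n + 1) =>
      incr (fun i => (lowPart (Λ i) g).eval (uexp θ)) j} ⊆ {θ | α / 2 ≤ T θ} ∪
      {θ | α / 4 < l2 fun j : Fin (n + 1) => (lowPart (Λ j) (A (k j))).eval (uexp θ)} := by
    intro θ hθ
    by_contra hcon
    simp only [Set.mem_union, Set.mem_ofPred_eq, not_or, not_le, not_lt] at hcon hθ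
    have hdec : (fun i => (lowPart (Λ i) g).eval (uexp θ)) = fun i =>
        (lowPart (Λ i) (A (k i))).eval (uexp θ) + (B (k i)).eval (uexp θ) +
          (P (k i)).eval (uexp θ) := by
      funext i
      rw [lowPart_eq hA hB (hpos i) rfl g, Polynomial.eval_add, Polynomial.eval_add]
    rw [hdec] at hθ
    have := l2_incr_add_le n (fun i => (lowPart (Λ i) (A (k i))).eval (uexp θ))
      (fun i => (B (k i)).eval (uexp θ)) fun i => (P (k i)).eval (uexp θ)
    have hTθ : T θ < α / 2 := hcon.1
    simp only [T] at hTθ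
    linarith [hcon.2]
  have hmeas := (measureReal_mono (μ := haarT) hsub).trans (measureReal_union_le _ _)
  have hg := polyNorm_nonneg g
  have hH := highConst_pos
  calc _ ≤ α * (haarT.real {θ | α / 2 ≤ T θ} + haarT.real {θ | α / 4 < l2 fun j : Fin (n + 1) =>
        (lowPart (Λ j) (A (k j))).eval (uexp θ)}) := by gcongr
    _ ≤ 2 * ((9 + 656 * Real.sqrt N) * polyNorm g) +
        4 * (Real.sqrt N * (highConst * (8 * polyNorm g))) := by linarith
    _ = (18 + 1312 * Real.sqrt N) * polyNorm g + 32 * highConst * Real.sqrt N * polyNorm g := by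
        ring
    _ ≤ (18 * Real.sqrt N + 1312 * Real.sqrt N) * polyNorm g +
        32 * highConst * Real.sqrt N * polyNorm g := by
        gcongr
        linarith
    _ = weakConst * Real.sqrt N * polyNorm g := by
        rw [weakConst]
        ring

/-! ### Polynomial approximation of analytic functions -/

/-- The de la Vallée Poussin mean of order `M` of an analytic function. -/
def vallee (g : Tor → ℂ) (M : ℕ) : Polynomial ℂ := ∑ n ∈ Finset.range (2 * M),
  Polynomial.monomial n ((((2 * M - n : ℕ) : ℂ) - ((M - n : ℕ) : ℂ)) / M * fourierCoeff g n)

lemma integral_fejer (N : ℕ) : ∫ s, fejer N s ∂haarT = N := by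
  have h := (hasMult_fejer N).2 0 0
  have h' := integral_sub_left_eq_self (fun s => (fejer N s : ℂ)) haarT 0
  simp only [pow_zero, mul_one, Nat.sub_zero] at h
  rw [h', integral_complex_ofReal] at h
  exact_mod_cast h

lemma eval_vallee {g : Tor → ℂ} (hg : Integrable g haarT)
    (hg0 : ∀ n < 0, fourierCoeff g n = 0) (M : ℕ) (θ : Tor) :
    (vallee g M).eval (uexp θ) =
      ∫ φ, (((fejer (2 * M) (θ - φ) - fejer M (θ - φ)) / M : ℝ) : ℂ) * g φ ∂haarT := by
  have hi : ∀ N, Integrable (fun φ => (fejer N (θ - φ) : ℂ) * g φ) haarT := fun N =>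
    integrable_mul_of_continuous (K := fun φ => (fejer N (θ - φ) : ℂ)) (by fun_prop) hg
  have h1 : ∀ φ, (((fejer (2 * M) (θ - φ) - fejer M (θ - φ)) / M : ℝ) : ℂ) * g φ =
      (M : ℂ)⁻¹ * ((fejer (2 * M) (θ - φ) : ℂ) * g φ - (fejer M (θ - φ) : ℂ) * g φ) := by
    intro φ
    push_cast
    ring
  have h2 : ∑ n ∈ Finset.range M, ((M - n : ℕ) : ℂ) * (fourierCoeff g n * uexp θ ^ n) =
      ∑ n ∈ Finset.range (2 * M), ((M - n : ℕ) : ℂ) * (fourierCoeff g n * uexp θ ^ n) := by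
    refine Finset.sum_subset (Finset.range_mono (by omega)) fun n _ hn => ?_
    rw [Nat.sub_eq_zero_of_le (by simpa using hn), Nat.cast_zero, zero_mul]
  simp_rw [h1]
  rw [integral_const_mul, integral_sub (hi _) (hi _), fejer_conv hg hg0, fejer_conv hg hg0, h2,
    ← Finset.sum_sub_distrib, vallee, Polynomial.eval_finsetSum, Finset.mul_sum]
  refine Finset.sum_congr rfl fun n _ => ?_
  rw [Polynomial.eval_monomial]
  ring

lemma polyNorm_vallee_le {g : Tor → ℂ} (hg : Integrable g haarT)
    (hg0 : ∀ n < 0, fourierCoeff g n = 0) {M : ℕ} (hM : 1 ≤ M) :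
    polyNorm (vallee g M) ≤ 3 * ∫ φ, ‖g φ‖ ∂haarT := by
  let W : Tor → ℝ := fun s => (fejer (2 * M) s + fejer M s) / M
  have hW : Continuous W := by fun_prop
  have hM0 : (0 : ℝ) < M := by exact_mod_cast hM
  have hprod : Integrable (Function.uncurry fun θ φ => W (θ - φ) * ‖g φ‖) (haarT.prod haarT) := by
    have hc : Continuous fun p : Tor × Tor => W (p.1 - p.2) := by fun_prop
    obtain ⟨C, hC⟩ := (isCompact_range hc).isBounded.exists_norm_le
    exact (hg.norm.comp_snd haarT).bdd_mul hc.aestronglyMeasurable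
      (.of_forall fun p => hC _ ⟨p, rfl⟩)
  have hle : ∀ θ, ‖(vallee g M).eval (uexp θ)‖ ≤ ∫ φ, W (θ - φ) * ‖g φ‖ ∂haarT := by
    intro θ
    rw [eval_vallee hg hg0]
    refine norm_integral_le_of_norm_le ?_ (.of_forall fun φ => ?_)
    · have hc : Continuous fun φ => W (θ - φ) := by fun_prop
      obtain ⟨C, hC⟩ := (isCompact_range hc).isBounded.exists_norm_le
      exact hg.norm.bdd_mul hc.aestronglyMeasurable (.of_forall fun p => hC _ ⟨p, rfl⟩)
    · rw [norm_mul, Complex.norm_real, Real.norm_eq_abs, abs_div, abs_of_pos hM0]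
      have h1 := fejer_nonneg (2 * M) (θ - φ)
      have h2 := fejer_nonneg M (θ - φ)
      have h3 : |fejer (2 * M) (θ - φ) - fejer M (θ - φ)| ≤
          fejer (2 * M) (θ - φ) + fejer M (θ - φ) := by
        rw [abs_le]
        constructor <;> linarith
      simp only [W]
      gcongr
  have hWint : ∀ φ, ∫ θ, W (θ - φ) ∂haarT = 3 := by
    intro φ
    rw [integral_sub_right_eq_self W φ]
    simp only [W]
    rw [integral_div, integral_add (integrable_haarT (by fun_prop)) (integrable_haarT (by fun_prop)),
      integral_fejer, integral_fejer]
    push_cast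
    field_simp
    norm_num
  calc polyNorm (vallee g M) ≤ ∫ θ, ∫ φ, W (θ - φ) * ‖g φ‖ ∂haarT ∂haarT :=
        integral_mono (integrable_haarT (by fun_prop)) hprod.integral_prod_left hle
    _ = ∫ φ, ∫ θ, W (θ - φ) * ‖g φ‖ ∂haarT ∂haarT := integral_integral_swap hprod
    _ = 3 * ∫ φ, ‖g φ‖ ∂haarT := by
        simp_rw [integral_mul_const, hWint]
        rw [integral_const_mul]

lemma coeff_vallee (g : Tor → ℂ) {M n : ℕ} (hM : 1 ≤ M) (hn : n < M) :
    (vallee g M).coeff n = fourierCoeff g n := by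
  have hM0 : (M : ℂ) ≠ 0 := by exact_mod_cast (by omega : M ≠ 0)
  simp only [vallee, Polynomial.finsetSum_coeff, Polynomial.coeff_monomial, Finset.sum_ite_eq',
    Finset.mem_range]
  rw [if_pos (by omega), Nat.cast_sub (by omega), Nat.cast_sub hn.le]
  push_cast
  field_simp
  ring

lemma eval_lowPart_eq_sum_range (N : ℕ) (g : Polynomial ℂ) (z : ℂ) :
    (lowPart N g).eval z = ∑ n ∈ Finset.range N, g.coeff n * z ^ n := by
  rw [eval_lowPart]
  refine Finset.sum_subset (fun n hn => Finset.mem_range.2 (Finset.mem_filter.1 hn).2)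
    fun n hn hn' => ?_
  have : g.coeff n = 0 := by
    by_contra h
    exact hn' (Finset.mem_filter.2 ⟨Polynomial.mem_support_iff.2 h, Finset.mem_range.1 hn⟩)
  rw [this, zero_mul]

/-! ### Littlewood–Paley projections of analytic functions -/

lemma sum_int_eq_sum_Ico {a : ℤ → ℂ} (ha : ∀ n < 0, a n = 0) {s : Finset ℤ} {m N : ℕ}
    (hs : ∀ n : ℤ, 0 ≤ n → (n ∈ s ↔ (m : ℤ) ≤ n ∧ n < N)) :
    ∑ n ∈ s, a n = ∑ n ∈ Finset.Ico m N, a n := by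
  have h1 : ∑ n ∈ (Finset.Ico m N).map Nat.castEmbedding, a n = ∑ n ∈ s, a n := by
    refine Finset.sum_subset (fun n hn => ?_) fun n hn hn' => ?_
    · obtain ⟨k, hk, rfl⟩ := Finset.mem_map.1 hn
      have := Finset.mem_Ico.1 hk
      exact (hs _ (by simp)).2 (by simpa using this)
    · rcases lt_or_ge n 0 with h | h
      · exact ha n h
      · have := (hs n h).1 hn
        lift n to ℕ using h
        exact absurd (Finset.mem_map.2 ⟨n, Finset.mem_Ico.2 (by simpa using this), rfl⟩) hn'
  rw [← h1, Finset.sum_map]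
  rfl

lemma LPproj_eq_incr {Λ : ℕ → ℕ} (hΛ : StrictMono Λ) (h0 : 0 < Λ 0) {g : Tor → ℂ}
    (hg0 : ∀ n < 0, fourierCoeff g n = 0) {j M : ℕ} (hj : Λ j ≤ M) (x : Tor) :
    LPproj Λ j g x = incr (fun i => (lowPart (Λ i) (vallee g M)).eval (uexp x)) j := by
  have ha : ∀ n < 0, fourierCoeff g n * fourier n x = 0 := fun n hn => by rw [hg0 n hn, zero_mul]
  have hlow : ∀ i, Λ i ≤ M → (lowPart (Λ i) (vallee g M)).eval (uexp x) =
      ∑ n ∈ Finset.range (Λ i), fourierCoeff g n * fourier n x := by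
    intro i hi
    rw [eval_lowPart_eq_sum_range]
    refine Finset.sum_congr rfl fun n hn => ?_
    have := Finset.mem_range.1 hn
    rw [coeff_vallee g (by omega) (by omega), fourier_eq_uexp_zpow, zpow_natCast]
  rcases j with _ | j
  · rw [incr_zero, hlow 0 hj, LPproj, if_pos rfl, Finset.range_eq_Ico]
    refine sum_int_eq_sum_Ico ha fun n hn => ?_
    rw [Finset.mem_Ioo]
    omega
  · have hlt : Λ j < Λ (j + 1) := hΛ j.lt_succ_self
    have hpos : 0 < Λ j := h0.trans_le (hΛ.monotone j.zero_le)
    rw [incr_succ, hlow _ hj, hlow _ (hlt.le.trans hj), LPproj, if_neg j.succ_ne_zero,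
      ← Finset.sum_Ico_eq_sub _ hlt.le]
    refine sum_int_eq_sum_Ico ha fun n hn => ?_
    rw [Finset.mem_union, Finset.mem_Ico, Finset.mem_Ioc, Nat.add_sub_cancel]
    omega

lemma weak_partial {Λ : ℕ → ℕ} (hΛ : StrictMono Λ) (h0 : 0 < Λ 0) (h1 : 1 < ratio Λ)
    (h2 : ratio Λ < 2) {g : Tor → ℂ} (hg : Integrable g haarT)
    (hg0 : ∀ n < 0, fourierCoeff g n = 0) (n : ℕ) {α : ℝ} (hα : 0 < α) :
    α * haarT.real {x | α < l2 fun j : Fin (n + 1) => LPproj Λ j g x} ≤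
      6 * weakConst * (ratio Λ - 1) ^ (-(1 : ℝ) / 2) * ∫ x, ‖g x‖ ∂haarT := by
  have hρ : 0 < ratio Λ - 1 := by linarith
  have hM : 1 ≤ Λ n := h0.trans_le (hΛ.monotone n.zero_le)
  have hw := weak_polynomial hΛ h0 h1 h2 (vallee g (Λ n)) n hα
  have hproj : ∀ x, (fun j : Fin (n + 1) => LPproj Λ j g x) = fun j : Fin (n + 1) =>
      incr (fun i => (lowPart (Λ i) (vallee g (Λ n))).eval (uexp x)) j := fun x =>
    funext fun j => LPproj_eq_incr hΛ h0 hg0 (hΛ.monotone (Nat.lt_succ_iff.1 j.2)) x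
  simp_rw [hproj]
  have hsqrt : Real.sqrt (2 / (ratio Λ - 1)) ≤ 2 * (ratio Λ - 1) ^ (-(1 : ℝ) / 2) := by
    rw [neg_div, Real.rpow_neg hρ.le, ← Real.sqrt_eq_rpow, ← Real.sqrt_inv,
      div_eq_mul_inv, Real.sqrt_mul zero_le_two]
    gcongr
    rw [Real.sqrt_le_left zero_le_two]
    norm_num
  have hC := weakConst_pos
  calc _ ≤ weakConst * Real.sqrt (2 / (ratio Λ - 1)) * polyNorm (vallee g (Λ n)) := hw
    _ ≤ weakConst * (2 * (ratio Λ - 1) ^ (-(1 : ℝ) / 2)) * (3 * ∫ x, ‖g x‖ ∂haarT) := by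
        have := polyNorm_nonneg (vallee g (Λ n))
        gcongr
        exact polyNorm_vallee_le hg hg0 hM
    _ = _ := by ring

lemma lt_LPsq {Λ : ℕ → ℕ} {g : Tor → ℂ} {α : ℝ} (hα : 0 < α) {x : Tor} (h : α < |LPsq Λ g x|) :
    ∃ n, α < l2 fun j : Fin (n + 1) => LPproj Λ j g x := by
  by_contra! hcon
  refine h.not_ge ?_
  rw [LPsq, abs_of_nonneg (Real.sqrt_nonneg _)]
  refine Real.sqrt_le_iff.2 ⟨hα.le, Real.tsum_le_of_sum_range_le (fun j => sq_nonneg _) fun n => ?_⟩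
  calc _ ≤ ∑ j ∈ Finset.range (n + 1), ‖LPproj Λ j g x‖ ^ 2 :=
        Finset.sum_le_sum_of_subset_of_nonneg (Finset.range_mono n.le_succ)
          fun j _ _ => sq_nonneg _
    _ = (l2 fun j : Fin (n + 1) => LPproj Λ j g x) ^ 2 := by
        rw [l2_sq, Fin.sum_univ_eq_sum_range (fun j => ‖LPproj Λ j g x‖ ^ 2)]
    _ ≤ α ^ 2 := by
        have := l2_nonneg fun j : Fin (n + 1) => LPproj Λ j g x
        have := hcon n
        gcongr

/-- There is an absolute constant `M₀ > 0` such that for every lacunary sequence `Λ` of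
positive integers with ratio `ρ_Λ ∈ (1,2)` and every `g ∈ H¹_A(𝕋)`,
`‖S^{(Λ)}(g)‖_{L^{1,∞}} ≤ M₀ (ρ_Λ - 1)^{-1/2} ‖g‖_{L¹}`. -/
theorem statement5 :
    ∃ M₀ : ℝ, 0 < M₀ ∧
      ∀ (Λ : ℕ → ℕ), StrictMono Λ → 0 < Λ 0 →
      1 < ratio Λ → ratio Λ < 2 →
      ∀ g : Tor → ℂ, Integrable g haarT →
        (∀ n : ℤ, n < 0 → fourierCoeff g n = 0) →
        wkNorm1 (LPsq Λ g) ≤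
          ENNReal.ofReal (M₀ * (ratio Λ - 1) ^ (-(1:ℝ)/2)) * eLpNorm g 1 haarT := by
  refine ⟨6 * weakConst, by have := weakConst_pos; positivity, ?_⟩
  intro Λ hΛ h0 h1 h2 g hg hg0
  have hρ : 0 < ratio Λ - 1 := by linarith
  have hC := weakConst_pos
  rw [eLpNorm_one_eq_lintegral_enorm, ← ofReal_integral_norm_eq_lintegral_enorm hg,
    ← ENNReal.ofReal_mul (by positivity)]
  refine iSup₂_le fun α hα => ?_
  let E : ℕ → Set Tor := fun n => {x | α < l2 fun j : Fin (n + 1) => LPproj Λ j g x}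
  have hE : Monotone E := by
    refine monotone_nat_of_le_succ fun n x hx => lt_of_lt_of_le hx (l2_mono ?_)
    rw [Fin.sum_univ_castSucc (n := n + 1)]
    exact le_add_of_nonneg_right (sq_nonneg _)
  have hsub : {x | α < |LPsq Λ g x|} ⊆ ⋃ n, E n := fun x hx => Set.mem_iUnion.2 (lt_LPsq hα hx)
  refine (mul_le_mul_right (measure_mono hsub) _).trans ?_
  rw [hE.measure_iUnion, ENNReal.mul_iSup]
  refine iSup_le fun n => ?_
  rw [← ofReal_measureReal, ← ENNReal.ofReal_mul hα.le]
  exact ENNReal.ofReal_le_ofReal (weak_partial hΛ h0 h1 h2 hg hg0 n hα)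

end
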